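/- arXiv:2312.06044 — 4 statements merged into one kernel-verified Lean document; each statement's English description precedes it below -/
import Mathlib

section
/- Let d ≥ 2 be an integer and let r, δ ∈ ℝ satisfy δ > 1, 0 ≤ r ≤ 1, and d > 1 + δ − 2r. Then there exists a constant C > 0 such that for all measurable F, G, H : ℝ^d → [0,∞) with finite L² norms, I₀(F, G, H) ≤ C ‖F‖_{L²} ‖G‖_{L²} ‖H‖_{L²}. -/
open MeasureTheory

/-- The function `μ_{r,δ}(ξ) = (|ξ₁| + |ξ|^δ)/|ξ|^r`. -/
noncomputable def muW (d : ℕ) (hd : 0 < d) (r δ : ℝ)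
    (ξ : EuclideanSpace ℝ (Fin d)) : ℝ :=
  (|ξ ⟨0, hd⟩| + ‖ξ‖ ^ δ) / ‖ξ‖ ^ r

/-- The region `E₀ ⊆ B(0,1)²` where `|ξ| + |η| ≤ 3||ξ| - |η||`. -/
def E0set (d : ℕ) : Set (EuclideanSpace ℝ (Fin d) × EuclideanSpace ℝ (Fin d)) :=
  {p | ‖p.1‖ < 1 ∧ ‖p.2‖ < 1 ∧ ‖p.1‖ + ‖p.2‖ ≤ 3 * |‖p.1‖ - ‖p.2‖|}

/-- The trilinear functional `I₀(F,G,H)` restricted to `E₀`. -/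
noncomputable def I0tri (d : ℕ) (hd : 0 < d) (r δ : ℝ)
    (F G H : EuclideanSpace ℝ (Fin d) → ℝ) : ENNReal :=
  ∫⁻ p in E0set d,
    ENNReal.ofReal (muW d hd r δ (p.1 + p.2) / (muW d hd r δ p.1 * muW d hd r δ p.2)) *
      ENNReal.ofReal (F p.1) * ENNReal.ofReal (G p.2) * ENNReal.ofReal (H (p.1 + p.2))

lemma muW_nonneg {d : ℕ} (hd : 0 < d) (r δ : ℝ) (ξ : EuclideanSpace ℝ (Fin d)) :
    0 ≤ muW d hd r δ ξ := by
  unfold muW; positivity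

lemma muW_add_le_of_two_mul_norm_le {d : ℕ} (hd : 0 < d) {r δ : ℝ} (hδ : 1 < δ) (hr0 : 0 ≤ r)
    {ξ η : EuclideanSpace ℝ (Fin d)} (h : 2 * ‖η‖ ≤ ‖ξ‖) :
    muW d hd r δ (ξ + η) ≤ 2 ^ δ * 2 ^ r * (muW d hd r δ ξ + muW d hd r δ η) := by
  rcases (norm_nonneg ξ).eq_or_lt with h0 | hξ
  · have hη : η = 0 := norm_le_zero_iff.1 (by linarith)
    have hξ : ξ = 0 := norm_eq_zero.1 h0.symm
    subst hη hξ
    simp [muW, Real.zero_rpow (by linarith : δ ≠ 0)]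
  have hs1 : ‖ξ‖ / 2 ≤ ‖ξ + η‖ := by
    have := norm_sub_norm_le ξ (-η)
    rw [norm_neg, sub_neg_eq_add] at this
    linarith
  have hs2 : ‖ξ + η‖ ≤ 2 * ‖ξ‖ := by
    have := norm_add_le ξ η
    have := norm_nonneg η
    linarith
  have hδ2 : (1 : ℝ) ≤ 2 ^ δ := Real.one_le_rpow (by norm_num) (by linarith)
  have hnum : |(ξ + η) ⟨0, hd⟩| + ‖ξ + η‖ ^ δ ≤
      2 ^ δ * ((|ξ ⟨0, hd⟩| + ‖ξ‖ ^ δ) + |η ⟨0, hd⟩|) := by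
    have h1 : ‖ξ + η‖ ^ δ ≤ 2 ^ δ * ‖ξ‖ ^ δ := by
      rw [← Real.mul_rpow (by norm_num) hξ.le]
      exact Real.rpow_le_rpow (norm_nonneg _) hs2 (by linarith)
    have h2 : |(ξ + η) ⟨0, hd⟩| ≤ |ξ ⟨0, hd⟩| + |η ⟨0, hd⟩| := abs_add_le _ _
    have h3 := le_mul_of_one_le_left (by positivity : 0 ≤ |ξ ⟨0, hd⟩| + |η ⟨0, hd⟩|) hδ2
    linarith
  have hden : ‖ξ‖ ^ r / 2 ^ r ≤ ‖ξ + η‖ ^ r := by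
    rw [← Real.div_rpow hξ.le (by norm_num)]
    exact Real.rpow_le_rpow (by positivity) hs1 hr0
  have hη : |η ⟨0, hd⟩| / ‖ξ‖ ^ r ≤ muW d hd r δ η := by
    rcases (norm_nonneg η).eq_or_lt with h0 | hη
    · have hη : η = 0 := norm_eq_zero.1 h0.symm
      subst hη
      simpa using muW_nonneg hd r δ 0
    · unfold muW
      have : ‖η‖ ^ r ≤ ‖ξ‖ ^ r := Real.rpow_le_rpow hη.le (by linarith) hr0
      have : (0 : ℝ) ≤ ‖η‖ ^ δ := by positivity
      gcongr
      linarith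
  calc muW d hd r δ (ξ + η)
      ≤ (2 ^ δ * ((|ξ ⟨0, hd⟩| + ‖ξ‖ ^ δ) + |η ⟨0, hd⟩|)) / (‖ξ‖ ^ r / 2 ^ r) := by
        unfold muW; gcongr
    _ = 2 ^ δ * 2 ^ r * (muW d hd r δ ξ + |η ⟨0, hd⟩| / ‖ξ‖ ^ r) := by
        unfold muW
        have : ‖ξ‖ ^ r ≠ 0 := by positivity
        field_simp
    _ ≤ _ := by gcongr

lemma muW_add_div_le {d : ℕ} (hd : 0 < d) {r δ : ℝ} (hδ : 1 < δ) (hr0 : 0 ≤ r)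
    {ξ η : EuclideanSpace ℝ (Fin d)} (h : ‖ξ‖ + ‖η‖ ≤ 3 * |‖ξ‖ - ‖η‖|) :
    muW d hd r δ (ξ + η) / (muW d hd r δ ξ * muW d hd r δ η) ≤
      2 ^ δ * 2 ^ r * ((muW d hd r δ ξ)⁻¹ + (muW d hd r δ η)⁻¹) := by
  have key : muW d hd r δ (ξ + η) ≤ 2 ^ δ * 2 ^ r * (muW d hd r δ ξ + muW d hd r δ η) := by
    rcases abs_cases (‖ξ‖ - ‖η‖) with ⟨h', _⟩ | ⟨h', _⟩
    · exact muW_add_le_of_two_mul_norm_le hd hδ hr0 (by linarith)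
    · rw [add_comm ξ, add_comm (muW d hd r δ ξ)]
      exact muW_add_le_of_two_mul_norm_le hd hδ hr0 (by linarith)
  have h1 := muW_nonneg hd r δ ξ
  have h2 := muW_nonneg hd r δ η
  rcases h1.eq_or_lt with h1' | h1'
  · rw [← h1']; simp; positivity
  rcases h2.eq_or_lt with h2' | h2'
  · rw [← h2']; simp; positivity
  rw [div_le_iff₀ (by positivity)]
  refine key.trans_eq ?_
  field_simp
  ring

lemma sq_inv_muW_le_prod {d : ℕ} (hd : 0 < d) {r δ e : ℝ} (he0 : 0 ≤ e) (he1 : e ≤ 1)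
    (he : 0 ≤ 2 * r - δ * (2 - e) + (d - 1) * e)
    {x : EuclideanSpace ℝ (Fin d)} (hx : ∀ i, x i ≠ 0) (hx1 : ‖x‖ < 1) :
    (muW d hd r δ x)⁻¹ ^ 2 ≤ ∏ i, |x i| ^ (-e) := by
  have ht : 0 < |x ⟨0, hd⟩| := abs_pos.2 (hx _)
  have hle : ∀ i, |x i| ≤ ‖x‖ := fun i => PiLp.norm_apply_le x i
  have hn : 0 < ‖x‖ := ht.trans_le (hle _)
  have hprod : |x ⟨0, hd⟩| ^ (-e) * ‖x‖ ^ (-((d - 1) * e)) ≤ ∏ i, |x i| ^ (-e) := by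
    rw [← Finset.mul_prod_erase Finset.univ _ (Finset.mem_univ ⟨0, hd⟩)]
    gcongr
    calc ‖x‖ ^ (-((d - 1) * e)) = ∏ i ∈ Finset.univ.erase (⟨0, hd⟩ : Fin d), ‖x‖ ^ (-e) := by
          rw [Finset.prod_const, ← Real.rpow_mul_natCast hn.le]
          simp [Nat.cast_sub hd]
          ring_nf
      _ ≤ _ := by
          refine Finset.prod_le_prod (fun _ _ => by positivity) fun i _ => ?_
          exact Real.rpow_le_rpow_of_nonpos (abs_pos.2 (hx i)) (hle i) (by linarith)
  refine le_trans ?_ hprod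
  have hnum : |x ⟨0, hd⟩| ^ e * ‖x‖ ^ (δ * (2 - e)) ≤ (|x ⟨0, hd⟩| + ‖x‖ ^ δ) ^ 2 := by
    have hs : 0 < |x ⟨0, hd⟩| + ‖x‖ ^ δ := by positivity
    rw [← Real.rpow_two, (by ring : (2 : ℝ) = e + (2 - e)), Real.rpow_add hs,
      Real.rpow_mul hn.le, (by ring : e + (2 - e) - e = 2 - e)]
    gcongr
    · exact le_add_of_nonneg_right (by positivity)
    · linarith
    · exact le_add_of_nonneg_left ht.le
  calc (muW d hd r δ x)⁻¹ ^ 2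
      = ‖x‖ ^ (r * 2) / (|x ⟨0, hd⟩| + ‖x‖ ^ δ) ^ 2 := by
        rw [muW, inv_div, div_pow, Real.rpow_mul hn.le, Real.rpow_two]
    _ ≤ ‖x‖ ^ (r * 2) / (|x ⟨0, hd⟩| ^ e * ‖x‖ ^ (δ * (2 - e))) := by gcongr
    _ = |x ⟨0, hd⟩| ^ (-e) * ‖x‖ ^ (r * 2 - δ * (2 - e)) := by
        rw [Real.rpow_sub hn, Real.rpow_neg ht.le]
        field_simp
    _ ≤ _ := by
        refine mul_le_mul_of_nonneg_left ?_ (by positivity)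
        exact Real.rpow_le_rpow_of_exponent_ge hn hx1.le (by linarith)

lemma integrable_indicator_abs_rpow {e : ℝ} (he : e < 1) :
    Integrable ((Set.Ioc (-1 : ℝ) 1).indicator fun t => |t| ^ (-e)) := by
  rw [integrable_indicator_iff measurableSet_Ioc,
    ← intervalIntegrable_iff_integrableOn_Ioc_of_le (by norm_num)]
  have h : IntervalIntegrable (fun t : ℝ => |t| ^ (-e)) volume 0 1 := by
    refine (intervalIntegral.intervalIntegrable_rpow' (r := -e) (by linarith)).congr ?_
    intro t ht
    rw [Set.uIoc_of_le zero_le_one] at ht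
    simp only [abs_of_pos ht.1]
  refine IntervalIntegrable.trans (b := 0) ?_ h
  simpa using ((IntervalIntegrable.iff_comp_neg (by simp)).1 h).symm

@[fun_prop]
lemma measurable_muW {d : ℕ} (hd : 0 < d) (r δ : ℝ) : Measurable (muW d hd r δ) := by
  unfold muW
  fun_prop

lemma lintegral_sq_inv_muW_lt_top {d : ℕ} (hd : 0 < d) {r δ : ℝ} (hδ : 1 < δ)
    (hdim : 1 + δ - 2 * r < (d : ℝ)) :
    ∫⁻ x in Metric.ball (0 : EuclideanSpace ℝ (Fin d)) 1,
      ENNReal.ofReal (muW d hd r δ x)⁻¹ ^ 2 < ⊤ := by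
  have hd1 : (1 : ℝ) ≤ d := by exact_mod_cast hd
  have hpos : 0 < δ + d - 1 := by linarith
  set e : ℝ := max (1 / 2) ((2 * δ - 2 * r) / (δ + d - 1)) with he_def
  have he0 : 0 ≤ e := le_max_of_le_left (by norm_num)
  have he1 : e < 1 := max_lt (by norm_num) ((div_lt_one hpos).2 (by linarith))
  have he : 0 ≤ 2 * r - δ * (2 - e) + (d - 1) * e := by
    have := (div_le_iff₀ hpos).1 (le_max_right (1 / 2) ((2 * δ - 2 * r) / (δ + d - 1)))
    rw [← he_def] at this
    linarith
  have hint : Integrable fun x : EuclideanSpace ℝ (Fin d) =>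
      ∏ i, (Set.Ioc (-1 : ℝ) 1).indicator (fun t => |t| ^ (-e)) (x i) :=
    (PiLp.volume_preserving_ofLp (Fin d)).integrable_comp_of_integrable
      (Integrable.fintype_prod fun _ => integrable_indicator_abs_rpow he1)
  have hne : ∀ᵐ x : EuclideanSpace ℝ (Fin d), ∀ i, x i ≠ 0 :=
    (PiLp.volume_preserving_ofLp (Fin d)).quasiMeasurePreserving.ae
      (ae_all_iff.2 fun i => Measure.ae_eval_ne _ i 0)
  refine lt_of_le_of_lt ?_ hint.lintegral_lt_top
  refine le_trans (setLIntegral_mono_ae' Metric.isOpen_ball.measurableSet ?_)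
    (setLIntegral_le_lintegral (Metric.ball 0 1) _)
  filter_upwards [hne] with x hx hx1
  rw [mem_ball_zero_iff] at hx1
  rw [← ENNReal.ofReal_pow (inv_nonneg.2 (muW_nonneg hd r δ x))]
  refine ENNReal.ofReal_le_ofReal ((sq_inv_muW_le_prod hd he0 he1.le he hx hx1).trans_eq ?_)
  refine Finset.prod_congr rfl fun i _ => ?_
  have hi := abs_lt.1 ((PiLp.norm_apply_le x i).trans_lt hx1)
  have hmem : x i ∈ Set.Ioc (-1 : ℝ) 1 := ⟨hi.1, hi.2.le⟩
  rw [Set.indicator_of_mem hmem]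

lemma lintegral_mul_le_sqrt_mul_sqrt {α : Type*} [MeasurableSpace α] (μ : Measure α)
    {f g : α → ENNReal} (hf : Measurable f) (hg : Measurable g) :
    ∫⁻ x, f x * g x ∂μ ≤
      (∫⁻ x, f x ^ 2 ∂μ) ^ (1 / 2 : ℝ) * (∫⁻ x, g x ^ 2 ∂μ) ^ (1 / 2 : ℝ) := by
  simpa [Pi.mul_apply] using
    ENNReal.lintegral_mul_le_Lp_mul_Lq μ Real.HolderConjugate.two_two hf.aemeasurable
      hg.aemeasurable

lemma lintegral_prod_convolution_le {E : Type*} [MeasurableSpace E] [AddCommGroup E]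
    [MeasurableAdd₂ E] (μ : Measure E) [SFinite μ] [μ.IsAddRightInvariant]
    {f g h m : E → ENNReal}
    (hf : Measurable f) (hg : Measurable g) (hh : Measurable h) (hm : Measurable m) :
    ∫⁻ p : E × E, f p.1 * (m p.2 * g p.2) * h (p.1 + p.2) ∂(μ.prod μ) ≤
      (∫⁻ x, m x ^ 2 ∂μ) ^ (1 / 2 : ℝ) * ((∫⁻ x, f x ^ 2 ∂μ) ^ (1 / 2 : ℝ) *
        ((∫⁻ x, g x ^ 2 ∂μ) ^ (1 / 2 : ℝ) * (∫⁻ x, h x ^ 2 ∂μ) ^ (1 / 2 : ℝ))) := by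
  rw [lintegral_prod_symm' _ (by fun_prop)]
  calc ∫⁻ y, ∫⁻ x, f x * (m y * g y) * h (x + y) ∂μ ∂μ
      ≤ ∫⁻ y, (m y * g y) * ((∫⁻ x, f x ^ 2 ∂μ) ^ (1 / 2 : ℝ) *
          (∫⁻ x, h x ^ 2 ∂μ) ^ (1 / 2 : ℝ)) ∂μ := by
        refine lintegral_mono fun y => ?_
        have h1 : ∫⁻ x, f x * (m y * g y) * h (x + y) ∂μ
            = (m y * g y) * ∫⁻ x, f x * h (x + y) ∂μ := by
          rw [← lintegral_const_mul _ (by fun_prop)]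
          congr with x
          ring
        rw [h1, ← lintegral_add_right_eq_self (fun x => h x ^ 2) y]
        gcongr
        exact lintegral_mul_le_sqrt_mul_sqrt μ hf (by fun_prop)
    _ = (∫⁻ y, m y * g y ∂μ) * ((∫⁻ x, f x ^ 2 ∂μ) ^ (1 / 2 : ℝ) *
          (∫⁻ x, h x ^ 2 ∂μ) ^ (1 / 2 : ℝ)) := lintegral_mul_const _ (by fun_prop)
    _ ≤ _ := by
        refine (mul_le_mul_left (lintegral_mul_le_sqrt_mul_sqrt μ hm hg) _).trans_eq ?_
        ring

lemma lintegral_prod_convolution_add_swap_le {E : Type*} [MeasurableSpace E] [AddCommGroup E]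
    [MeasurableAdd₂ E] (μ : Measure E) [SFinite μ] [μ.IsAddRightInvariant] (K : ENNReal)
    {f g h m : E → ENNReal}
    (hf : Measurable f) (hg : Measurable g) (hh : Measurable h) (hm : Measurable m) :
    ∫⁻ p : E × E, K * (f p.1 * (m p.2 * g p.2) * h (p.1 + p.2) +
        g p.2 * (m p.1 * f p.1) * h (p.2 + p.1)) ∂(μ.prod μ) ≤
      K * (2 * (∫⁻ x, m x ^ 2 ∂μ) ^ (1 / 2 : ℝ)) * ((∫⁻ x, f x ^ 2 ∂μ) ^ (1 / 2 : ℝ) *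
        ((∫⁻ x, g x ^ 2 ∂μ) ^ (1 / 2 : ℝ) * (∫⁻ x, h x ^ 2 ∂μ) ^ (1 / 2 : ℝ))) := by
  have hswap : ∫⁻ p : E × E, g p.2 * (m p.1 * f p.1) * h (p.2 + p.1) ∂(μ.prod μ) =
      ∫⁻ p : E × E, g p.1 * (m p.2 * f p.2) * h (p.1 + p.2) ∂(μ.prod μ) :=
    lintegral_prod_swap fun p : E × E => g p.1 * (m p.2 * f p.2) * h (p.1 + p.2)
  rw [lintegral_const_mul _ (by fun_prop), lintegral_add_left (by fun_prop), hswap, mul_assoc]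
  refine mul_le_mul_right ((add_le_add (lintegral_prod_convolution_le μ hf hg hh hm)
    (lintegral_prod_convolution_le μ hg hf hh hm)).trans_eq ?_) K
  ring

lemma measurableSet_E0set (d : ℕ) : MeasurableSet (E0set d) := by
  have h1 : Measurable fun p : EuclideanSpace ℝ (Fin d) × EuclideanSpace ℝ (Fin d) => ‖p.1‖ := by
    fun_prop
  have h2 : Measurable fun p : EuclideanSpace ℝ (Fin d) × EuclideanSpace ℝ (Fin d) => ‖p.2‖ := by
    fun_prop
  exact (measurableSet_lt h1 measurable_const).inter ((measurableSet_lt h2 measurable_const).inter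
    (measurableSet_le (h1.add h2) ((h1.sub h2).norm.const_mul 3)))

theorem stmt12 (d : ℕ) (hd : 2 ≤ d) (r δ : ℝ) (hδ : 1 < δ)
    (hr0 : 0 ≤ r) (hr1 : r ≤ 1) (hdim : 1 + δ - 2 * r < (d : ℝ)) :
    ∃ C : ℝ, 0 < C ∧ ∀ F G H : EuclideanSpace ℝ (Fin d) → ℝ,
      Measurable F → (∀ ξ, 0 ≤ F ξ) → Measurable G → (∀ ξ, 0 ≤ G ξ) →
      Measurable H → (∀ ξ, 0 ≤ H ξ) →
      (∫⁻ ξ, ENNReal.ofReal (F ξ) ^ 2) < ⊤ →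
      (∫⁻ ξ, ENNReal.ofReal (G ξ) ^ 2) < ⊤ →
      (∫⁻ ξ, ENNReal.ofReal (H ξ) ^ 2) < ⊤ →
      I0tri d (by omega) r δ F G H ≤
        ENNReal.ofReal C * ((∫⁻ ξ, ENNReal.ofReal (F ξ) ^ 2) ^ (1/2 : ℝ) *
          ((∫⁻ ξ, ENNReal.ofReal (G ξ) ^ 2) ^ (1/2 : ℝ) *
           (∫⁻ ξ, ENNReal.ofReal (H ξ) ^ 2) ^ (1/2 : ℝ))) := by
  have hd0 : 0 < d := by omega
  set B := Metric.ball (0 : EuclideanSpace ℝ (Fin d)) 1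
  have hB : MeasurableSet B := Metric.isOpen_ball.measurableSet
  set m : EuclideanSpace ℝ (Fin d) → ENNReal :=
    B.indicator fun x => ENNReal.ofReal (muW d hd0 r δ x)⁻¹
  have hm : Measurable m := Measurable.indicator (by fun_prop) hB
  set N : ENNReal := (∫⁻ x, m x ^ 2) ^ (1 / 2 : ℝ)
  have hN : N ≠ ⊤ := by
    refine ENNReal.rpow_ne_top_of_nonneg (by norm_num) ?_
    have : ∀ x, m x ^ 2 = B.indicator (fun x => ENNReal.ofReal (muW d hd0 r δ x)⁻¹ ^ 2) x := by
      intro x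
      by_cases hx : x ∈ B <;> simp [m, hx]
    simp_rw [this]
    rw [lintegral_indicator hB]
    exact (lintegral_sq_inv_muW_lt_top hd0 hδ hdim).ne
  set K : ENNReal := ENNReal.ofReal (2 ^ δ * 2 ^ r)
  have hK : K * (2 * N) ≠ ⊤ :=
    ENNReal.mul_ne_top ENNReal.ofReal_ne_top (ENNReal.mul_ne_top (by simp) hN)
  refine ⟨(K * (2 * N)).toReal + 1, by positivity, fun F G H hF _ hG _ hH _ _ _ _ => ?_⟩
  set f := fun x => ENNReal.ofReal (F x)
  set g := fun x => ENNReal.ofReal (G x)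
  set h := fun x => ENNReal.ofReal (H x)
  have hf : Measurable f := by fun_prop
  have hg : Measurable g := by fun_prop
  have hh : Measurable h := by fun_prop
  have hpt : ∀ p ∈ E0set d,
      ENNReal.ofReal (muW d hd0 r δ (p.1 + p.2) / (muW d hd0 r δ p.1 * muW d hd0 r δ p.2)) *
        ENNReal.ofReal (F p.1) * ENNReal.ofReal (G p.2) * ENNReal.ofReal (H (p.1 + p.2)) ≤
      K * (f p.1 * (m p.2 * g p.2) * h (p.1 + p.2) +
        g p.2 * (m p.1 * f p.1) * h (p.2 + p.1)) := by
    rintro ⟨ξ, η⟩ ⟨hξ, hη, hξη⟩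
    have h1 : ENNReal.ofReal (muW d hd0 r δ (ξ + η) / (muW d hd0 r δ ξ * muW d hd0 r δ η)) ≤
        K * (m ξ + m η) := by
      have hmξ : m ξ = ENNReal.ofReal (muW d hd0 r δ ξ)⁻¹ :=
        Set.indicator_of_mem (mem_ball_zero_iff.2 hξ) _
      have hmη : m η = ENNReal.ofReal (muW d hd0 r δ η)⁻¹ :=
        Set.indicator_of_mem (mem_ball_zero_iff.2 hη) _
      rw [hmξ, hmη, ← ENNReal.ofReal_add (inv_nonneg.2 (muW_nonneg ..))
        (inv_nonneg.2 (muW_nonneg ..)), ← ENNReal.ofReal_mul (by positivity)]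
      exact ENNReal.ofReal_le_ofReal (muW_add_div_le hd0 hδ hr0 hξη)
    calc _ ≤ K * (m ξ + m η) * f ξ * g η * h (ξ + η) := by gcongr
      _ = _ := by rw [add_comm η ξ]; ring
  have hI : I0tri d hd0 r δ F G H ≤
      K * (2 * N) * ((∫⁻ x, f x ^ 2) ^ (1 / 2 : ℝ) *
        ((∫⁻ x, g x ^ 2) ^ (1 / 2 : ℝ) * (∫⁻ x, h x ^ 2) ^ (1 / 2 : ℝ))) :=
    (setLIntegral_mono' (measurableSet_E0set d) hpt).trans
      ((setLIntegral_le_lintegral _ _).trans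
        (lintegral_prod_convolution_add_swap_le volume K hf hg hh hm))
  refine hI.trans (mul_le_mul_left ?_ _)
  rw [← ENNReal.ofReal_toReal hK]
  exact ENNReal.ofReal_le_ofReal (by simp)
end

section
/- Let d = 2 and let r, δ ∈ ℝ with r > 0 and δ > 2. Then there does NOT exist a constant C > 0 such that I(F, G, H) ≤ C ‖F‖_{L²} ‖G‖_{L²} ‖H‖_{L²} for all measurable F, G, H : ℝ² → [0,∞) with finite L² norms. -/
open MeasureTheory

/-- The function `μ_{r,δ}(ξ) = (|ξ₁| + |ξ|^δ)/|ξ|^r` on `ℝ²`. -/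
noncomputable def muW2 (r δ : ℝ) (ξ : EuclideanSpace ℝ (Fin 2)) : ℝ :=
  (|ξ 0| + ‖ξ‖ ^ δ) / ‖ξ‖ ^ r

/-- The trilinear functional `I(F,G,H)` on `ℝ²`. -/
noncomputable def Itri2 (r δ : ℝ) (F G H : EuclideanSpace ℝ (Fin 2) → ℝ) : ENNReal :=
  ∫⁻ ξ in Metric.ball (0 : EuclideanSpace ℝ (Fin 2)) 1,
    ∫⁻ η in Metric.ball (0 : EuclideanSpace ℝ (Fin 2)) 1,
      ENNReal.ofReal (muW2 r δ (ξ + η) / (muW2 r δ ξ * muW2 r δ η)) *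
        ENNReal.ofReal (F ξ) * ENNReal.ofReal (G η) * ENNReal.ofReal (H (ξ + η))

open Metric Filter Topology

/-- The indicator function of the ball of radius `ε` about `a` in `ℝ²`. -/
noncomputable def ballIndicator (a : EuclideanSpace ℝ (Fin 2)) (ε : ℝ) :
    EuclideanSpace ℝ (Fin 2) → ℝ :=
  (ball a ε).indicator 1

lemma measurable_ballIndicator (a : EuclideanSpace ℝ (Fin 2)) (ε : ℝ) :
    Measurable (ballIndicator a ε) :=
  measurable_one.indicator measurableSet_ball

lemma ballIndicator_nonneg (a : EuclideanSpace ℝ (Fin 2)) (ε : ℝ) (ξ) :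
    0 ≤ ballIndicator a ε ξ :=
  Set.indicator_nonneg (fun _ _ => zero_le_one) ξ

lemma ballIndicator_of_mem {a ξ : EuclideanSpace ℝ (Fin 2)} {ε : ℝ} (h : ξ ∈ ball a ε) :
    ballIndicator a ε ξ = 1 :=
  Set.indicator_of_mem h 1

lemma volume_ball_two (a : EuclideanSpace ℝ (Fin 2)) {ε : ℝ} (hε : 0 ≤ ε) :
    volume (ball a ε) = ENNReal.ofReal (Real.pi * ε ^ 2) := by
  rw [EuclideanSpace.volume_ball_fin_two, ← ENNReal.ofReal_pow hε, mul_comm,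
    ENNReal.ofReal_mul Real.pi_pos.le]

lemma lintegral_ballIndicator_sq (a : EuclideanSpace ℝ (Fin 2)) {ε : ℝ} (hε : 0 ≤ ε) :
    ∫⁻ ξ, ENNReal.ofReal (ballIndicator a ε ξ) ^ 2 = ENNReal.ofReal (Real.pi * ε ^ 2) := by
  rw [← volume_ball_two a hε, ← lintegral_indicator_one measurableSet_ball]
  refine lintegral_congr fun ξ => ?_
  by_cases h : ξ ∈ ball a ε <;> simp [ballIndicator, h]

lemma rpow_half_ofReal_pi_mul_sq {ε : ℝ} (hε : 0 ≤ ε) :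
    ENNReal.ofReal (Real.pi * ε ^ 2) ^ (1 / 2 : ℝ) = ENNReal.ofReal (√Real.pi * ε) := by
  rw [ENNReal.ofReal_rpow_of_nonneg (by positivity) (by norm_num), ← Real.sqrt_eq_rpow,
    Real.sqrt_mul Real.pi_pos.le, Real.sqrt_sq hε]

/-- A lower bound for the multiplier on a product of balls bounds `Itri2` from below. -/
lemma le_Itri2_ballIndicator {r δ ε m : ℝ} {a b : EuclideanSpace ℝ (Fin 2)} (hε : 0 ≤ ε)
    (ha : ball a ε ⊆ ball 0 1) (hb : ball b ε ⊆ ball 0 1)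
    (hm : ∀ ξ ∈ ball a ε, ∀ η ∈ ball b ε,
      m ≤ muW2 r δ (ξ + η) / (muW2 r δ ξ * muW2 r δ η)) :
    ENNReal.ofReal m * ENNReal.ofReal (Real.pi * ε ^ 2) * ENNReal.ofReal (Real.pi * ε ^ 2) ≤
      Itri2 r δ (ballIndicator a ε) (ballIndicator b ε) (ballIndicator (a + b) (2 * ε)) := by
  calc _ = ∫⁻ _ξ in ball a ε, ∫⁻ _η in ball b ε, ENNReal.ofReal m := by
        simp only [setLIntegral_const, volume_ball_two _ hε]
    _ ≤ ∫⁻ ξ in ball a ε, ∫⁻ η in ball b ε,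
          ENNReal.ofReal (muW2 r δ (ξ + η) / (muW2 r δ ξ * muW2 r δ η)) *
            ENNReal.ofReal (ballIndicator a ε ξ) * ENNReal.ofReal (ballIndicator b ε η) *
            ENNReal.ofReal (ballIndicator (a + b) (2 * ε) (ξ + η)) := by
        refine setLIntegral_mono' measurableSet_ball fun ξ hξ =>
          setLIntegral_mono' measurableSet_ball fun η hη => ?_
        have h : ξ + η ∈ ball (a + b) (2 * ε) := by
          rw [mem_ball] at *
          linarith [dist_add_add_le ξ η a b]
        rw [ballIndicator_of_mem hξ, ballIndicator_of_mem hη, ballIndicator_of_mem h]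
        simpa using ENNReal.ofReal_le_ofReal (hm ξ hξ η hη)
    _ ≤ _ := (lintegral_mono fun ξ => lintegral_mono_set hb).trans (lintegral_mono_set ha)

/-- A trilinear `L²` bound forces the multiplier to be `O(1/ε)` on products of `ε`-balls. -/
lemma mul_le_of_trilinear_bound {r δ C ε m : ℝ} {a b : EuclideanSpace ℝ (Fin 2)}
    (hC : 0 < C) (hε : 0 < ε) (hm0 : 0 ≤ m)
    (ha : ball a ε ⊆ ball 0 1) (hb : ball b ε ⊆ ball 0 1)
    (hm : ∀ ξ ∈ ball a ε, ∀ η ∈ ball b ε,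
      m ≤ muW2 r δ (ξ + η) / (muW2 r δ ξ * muW2 r δ η))
    (hbound : ∀ F G H : EuclideanSpace ℝ (Fin 2) → ℝ,
      Measurable F → (∀ ξ, 0 ≤ F ξ) → Measurable G → (∀ ξ, 0 ≤ G ξ) →
      Measurable H → (∀ ξ, 0 ≤ H ξ) →
      (∫⁻ ξ, ENNReal.ofReal (F ξ) ^ 2) < ⊤ →
      (∫⁻ ξ, ENNReal.ofReal (G ξ) ^ 2) < ⊤ →
      (∫⁻ ξ, ENNReal.ofReal (H ξ) ^ 2) < ⊤ →
      Itri2 r δ F G H ≤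
        ENNReal.ofReal C * ((∫⁻ ξ, ENNReal.ofReal (F ξ) ^ 2) ^ (1/2 : ℝ) *
          ((∫⁻ ξ, ENNReal.ofReal (G ξ) ^ 2) ^ (1/2 : ℝ) *
           (∫⁻ ξ, ENNReal.ofReal (H ξ) ^ 2) ^ (1/2 : ℝ)))) :
    m * ε ≤ 2 * C := by
  have h2ε : 0 ≤ 2 * ε := by positivity
  have h := (le_Itri2_ballIndicator hε.le ha hb hm).trans <| hbound _ _ _
    (measurable_ballIndicator a ε) (ballIndicator_nonneg a ε)
    (measurable_ballIndicator b ε) (ballIndicator_nonneg b ε)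
    (measurable_ballIndicator (a + b) (2 * ε)) (ballIndicator_nonneg (a + b) (2 * ε))
    (by rw [lintegral_ballIndicator_sq _ hε.le]; exact ENNReal.ofReal_lt_top)
    (by rw [lintegral_ballIndicator_sq _ hε.le]; exact ENNReal.ofReal_lt_top)
    (by rw [lintegral_ballIndicator_sq _ h2ε]; exact ENNReal.ofReal_lt_top)
  rw [lintegral_ballIndicator_sq _ hε.le, lintegral_ballIndicator_sq _ hε.le,
    lintegral_ballIndicator_sq _ h2ε, rpow_half_ofReal_pi_mul_sq hε.le,
    rpow_half_ofReal_pi_mul_sq h2ε, ← ENNReal.ofReal_mul hm0,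
    ← ENNReal.ofReal_mul (by positivity), ← ENNReal.ofReal_mul (by positivity),
    ← ENNReal.ofReal_mul (by positivity), ← ENNReal.ofReal_mul hC.le,
    ENNReal.ofReal_le_ofReal_iff (by positivity)] at h
  have hs : 1 ≤ √Real.pi := Real.one_le_sqrt.2 (by linarith [Real.pi_gt_three])
  have hpi : Real.pi = √Real.pi ^ 2 := (Real.sq_sqrt Real.pi_pos.le).symm
  set s := √Real.pi
  rw [hpi] at h
  have hpos : 0 < s ^ 3 * ε ^ 3 := by positivity
  have h' : m * ε * s ≤ 2 * C := by
    refine le_of_mul_le_mul_left ?_ hpos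
    linarith
  exact (le_mul_of_one_le_right (by positivity) hs).trans h'

lemma muW2_pos_and_le {r δ ν : ℝ} {ξ : EuclideanSpace ℝ (Fin 2)} (hr : 0 < r) (hδ : 0 < δ)
    (hν : 0 < ν) (h0 : |ξ 0| ≤ 3 * ν ^ δ) (hlo : ν / 2 ≤ ‖ξ‖) (hhi : ‖ξ‖ ≤ 2 * ν) :
    0 < muW2 r δ ξ ∧ muW2 r δ ξ ≤ (3 + 2 ^ δ) * 2 ^ r * (ν ^ δ / ν ^ r) := by
  have hpos : 0 < ‖ξ‖ := by linarith
  refine ⟨by unfold muW2; positivity, ?_⟩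
  have h1 : ‖ξ‖ ^ δ ≤ 2 ^ δ * ν ^ δ := by
    rw [← Real.mul_rpow (by norm_num) hν.le]
    exact Real.rpow_le_rpow hpos.le hhi hδ.le
  have h2 : ν ^ r / 2 ^ r ≤ ‖ξ‖ ^ r := by
    rw [← Real.div_rpow hν.le (by norm_num)]
    exact Real.rpow_le_rpow (by positivity) hlo hr.le
  calc muW2 r δ ξ ≤ (3 * ν ^ δ + 2 ^ δ * ν ^ δ) / (ν ^ r / 2 ^ r) := by
        unfold muW2; gcongr
    _ = _ := by field_simp

lemma le_muW2 {r δ ε : ℝ} {ζ : EuclideanSpace ℝ (Fin 2)} (hr : 0 < r)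
    (hε : 0 < ε) (h0 : 2 * ε ≤ ζ 0) (hhi : ‖ζ‖ ≤ 8 * ε) :
    2 / 8 ^ r * (ε / ε ^ r) ≤ muW2 r δ ζ := by
  have hpos : 0 < ‖ζ‖ := by
    have := PiLp.norm_apply_le ζ 0
    rw [Real.norm_eq_abs] at this
    linarith [le_abs_self (ζ 0)]
  calc 2 / 8 ^ r * (ε / ε ^ r) = 2 * ε / (8 * ε) ^ r := by
        rw [Real.mul_rpow (by norm_num) hε.le]; field_simp
    _ ≤ muW2 r δ ζ := by
        unfold muW2
        gcongr
        linarith [le_abs_self (ζ 0), Real.rpow_nonneg hpos.le δ]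

lemma norm_le_abs_add_abs (ξ : EuclideanSpace ℝ (Fin 2)) : ‖ξ‖ ≤ |ξ 0| + |ξ 1| := by
  rw [EuclideanSpace.norm_eq, Fin.sum_univ_two, Real.norm_eq_abs, Real.norm_eq_abs]
  refine Real.sqrt_le_iff.2 ⟨by positivity, ?_⟩
  nlinarith [mul_nonneg (abs_nonneg (ξ 0)) (abs_nonneg (ξ 1))]

lemma abs_sub_apply_lt {a ξ : EuclideanSpace ℝ (Fin 2)} {ε : ℝ} (h : ξ ∈ ball a ε) (i : Fin 2) :
    |ξ i - a i| < ε := by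
  rw [mem_ball, dist_eq_norm] at h
  exact (PiLp.norm_apply_le (ξ - a) i).trans_lt h

/-- Points of the `ε`-balls about `(2ε, ±ν)` have norm comparable to `ν`. -/
lemma bounds_of_mem_ball {ε ν s : ℝ} {ξ : EuclideanSpace ℝ (Fin 2)} (hε : 0 < ε)
    (hεν : 8 * ε ≤ ν) (hs : |s| = ν) (h : ξ ∈ ball !₂[2 * ε, s] ε) :
    |ξ 0| ≤ 3 * ε ∧ ν / 2 ≤ ‖ξ‖ ∧ ‖ξ‖ ≤ 2 * ν := by
  have h0 : |ξ 0 - 2 * ε| < ε := by simpa using abs_sub_apply_lt h 0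
  have h1 : |ξ 1 - s| < ε := by simpa using abs_sub_apply_lt h 1
  have h0' : |ξ 0| ≤ 3 * ε := by
    rw [abs_lt] at h0
    rw [abs_le]; constructor <;> linarith
  have hlo := abs_sub_abs_le_abs_sub s (ξ 1)
  have hhi := abs_sub_abs_le_abs_sub (ξ 1) s
  rw [abs_sub_comm] at hlo
  have hn := PiLp.norm_apply_le ξ 1
  rw [Real.norm_eq_abs] at hn
  exact ⟨h0', by linarith, by linarith [norm_le_abs_add_abs ξ]⟩

/-- Near-antipodal high frequencies of size `ν` with sum of size `ν ^ δ` make the multiplier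
large. -/
lemma le_multiplier {r δ ν : ℝ} {ξ η : EuclideanSpace ℝ (Fin 2)} (hr : 0 < r) (hδ : 0 < δ)
    (hν : 0 < ν) (hεν : 8 * ν ^ δ ≤ ν) (hξ : ξ ∈ ball !₂[2 * ν ^ δ, ν] (ν ^ δ))
    (hη : η ∈ ball !₂[2 * ν ^ δ, -ν] (ν ^ δ)) :
    2 / 8 ^ r / ((3 + 2 ^ δ) * 2 ^ r) ^ 2 * ν ^ ((2 - δ) * r) / ν ^ δ ≤
      muW2 r δ (ξ + η) / (muW2 r δ ξ * muW2 r δ η) := by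
  have hε : 0 < ν ^ δ := by positivity
  obtain ⟨a0, alo, ahi⟩ := bounds_of_mem_ball hε hεν (abs_of_pos hν) hξ
  obtain ⟨b0, blo, bhi⟩ := bounds_of_mem_ball hε hεν (by rw [abs_neg, abs_of_pos hν]) hη
  obtain ⟨apos, ale⟩ := muW2_pos_and_le hr hδ hν a0 alo ahi
  obtain ⟨bpos, ble⟩ := muW2_pos_and_le hr hδ hν b0 blo bhi
  have hx0 : |ξ 0 - 2 * ν ^ δ| < ν ^ δ := by simpa using abs_sub_apply_lt hξ 0
  have hx1 : |ξ 1 - ν| < ν ^ δ := by simpa using abs_sub_apply_lt hξ 1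
  have hy0 : |η 0 - 2 * ν ^ δ| < ν ^ δ := by simpa using abs_sub_apply_lt hη 0
  have hy1 : |η 1 - -ν| < ν ^ δ := by simpa using abs_sub_apply_lt hη 1
  rw [abs_lt] at hx0 hx1 hy0 hy1
  have hz := le_muW2 (r := r) (δ := δ) (ζ := ξ + η) hr hε
    (by rw [PiLp.add_apply]; linarith) (by
      have h0 : |(ξ + η) 0| ≤ 6 * ν ^ δ := by
        rw [PiLp.add_apply, abs_le]; constructor <;> linarith
      have h1 : |(ξ + η) 1| ≤ 2 * ν ^ δ := by
        rw [PiLp.add_apply, abs_le]; constructor <;> linarith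
      linarith [norm_le_abs_add_abs (ξ + η)])
  refine le_trans (le_of_eq ?_) (div_le_div₀ (le_trans (by positivity) hz) hz (by positivity)
    (mul_le_mul ale ble bpos.le (by positivity)))
  have hexp : ν ^ ((2 - δ) * r) = ν ^ r * ν ^ r / (ν ^ δ) ^ r := by
    rw [← Real.rpow_mul hν.le, ← Real.rpow_add hν, ← Real.rpow_sub hν]
    congr 1; ring
  rw [hexp]
  field_simp

theorem stmt16 (r δ : ℝ) (hr : 0 < r) (hδ : 2 < δ) :
    ¬ ∃ C : ℝ, 0 < C ∧ ∀ F G H : EuclideanSpace ℝ (Fin 2) → ℝ,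
      Measurable F → (∀ ξ, 0 ≤ F ξ) → Measurable G → (∀ ξ, 0 ≤ G ξ) →
      Measurable H → (∀ ξ, 0 ≤ H ξ) →
      (∫⁻ ξ, ENNReal.ofReal (F ξ) ^ 2) < ⊤ →
      (∫⁻ ξ, ENNReal.ofReal (G ξ) ^ 2) < ⊤ →
      (∫⁻ ξ, ENNReal.ofReal (H ξ) ^ 2) < ⊤ →
      Itri2 r δ F G H ≤
        ENNReal.ofReal C * ((∫⁻ ξ, ENNReal.ofReal (F ξ) ^ 2) ^ (1/2 : ℝ) *
          ((∫⁻ ξ, ENNReal.ofReal (G ξ) ^ 2) ^ (1/2 : ℝ) *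
           (∫⁻ ξ, ENNReal.ofReal (H ξ) ^ 2) ^ (1/2 : ℝ))) := by
  rintro ⟨C, hC, hbound⟩
  have hδ0 : 0 < δ := by linarith
  set c : ℝ := 2 / 8 ^ r / ((3 + 2 ^ δ) * 2 ^ r) ^ 2
  have hcpos : 0 < c := by positivity
  have hlim : Tendsto (fun ν : ℝ => c * ν ^ ((2 - δ) * r)) (𝓝[>] 0) atTop :=
    (tendsto_rpow_neg_nhdsGT_zero (by nlinarith)).const_mul_atTop hcpos
  have hsmall : ∀ᶠ ν : ℝ in 𝓝[>] 0, ν < 1 / 8 :=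
    eventually_nhdsWithin_of_eventually_nhds (eventually_lt_nhds (by norm_num))
  obtain ⟨ν, hlarge, hν8, hν : 0 < ν⟩ :=
    ((hlim.eventually_gt_atTop (2 * C)).and (hsmall.and self_mem_nhdsWithin)).exists
  have hε : 0 < ν ^ δ := by positivity
  have hεν : 8 * ν ^ δ ≤ ν := by
    have : ν ^ δ ≤ ν ^ (2 : ℝ) :=
      Real.rpow_le_rpow_of_exponent_ge hν (by linarith) hδ.le
    rw [Real.rpow_two] at this
    nlinarith
  have hsub : ∀ s : ℝ, |s| = ν → ball !₂[2 * ν ^ δ, s] (ν ^ δ) ⊆ ball 0 1 := fun s hs ξ hξ => by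
    rw [mem_ball_zero_iff]
    linarith [(bounds_of_mem_ball hε hεν hs hξ).2.2]
  have key := mul_le_of_trilinear_bound (m := c * ν ^ ((2 - δ) * r) / ν ^ δ) hC hε (by positivity)
    (hsub ν (abs_of_pos hν)) (hsub (-ν) (by rw [abs_neg, abs_of_pos hν]))
    (fun ξ hξ η hη => le_multiplier hr hδ0 hν hεν hξ hη) hbound
  rw [div_mul_cancel₀ _ hε.ne'] at key
  linarith
end

section
/- Let d ≥ 2 be an integer and let s, r, δ ∈ ℝ satisfy δ > 1, d > 1 + δ − 2r, r ≤ 1, and s > d/2, and suppose either d ≥ 3, or d = 2 and δ ≤ 2. Then there exists a constant C > 0 such that for all measurable F, G : ℝ^d → [0,∞), ∫_{ℝ^d} ω_{s,r,δ}(ξ) (F∗G)(ξ)² dξ ≤ C² (∫_{ℝ^d} ω_{s,r,δ}(ξ) F(ξ)² dξ)(∫_{ℝ^d} ω_{s,r,δ}(ξ) G(ξ)² dξ). (This expresses on the Fourier side that X^s_{r,δ}(ℝ^d) is a Banach algebra under pointwise multiplication in this parameter regime.) -/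
open MeasureTheory

/-- The anisotropic weight `ω_{s,r,δ}`. -/
noncomputable def omegaW (d : ℕ) (hd : 0 < d) (s r δ : ℝ)
    (ξ : EuclideanSpace ℝ (Fin d)) : ENNReal :=
  if ‖ξ‖ < 1 then ENNReal.ofReal ((|ξ ⟨0, hd⟩| ^ 2 + ‖ξ‖ ^ (2 * δ)) / ‖ξ‖ ^ (2 * r))
  else ENNReal.ofReal ((1 + ‖ξ‖ ^ 2) ^ s)

/-- Convolution of two nonnegative functions, valued in `[0,∞]`. -/
noncomputable def convNN (d : ℕ) (F G : EuclideanSpace ℝ (Fin d) → ℝ)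
    (ξ : EuclideanSpace ℝ (Fin d)) : ENNReal :=
  ∫⁻ η, ENNReal.ofReal (F (ξ - η)) * ENNReal.ofReal (G η)

open scoped ENNReal

/-- Cauchy–Schwarz -/
theorem lintegral_mul_sq_le {α : Type*} [MeasurableSpace α] (μ : Measure α) {f g : α → ℝ≥0∞}
    (hf : Measurable f) (hg : Measurable g) :
    (∫⁻ x, f x * g x ∂μ) ^ 2 ≤ (∫⁻ x, f x ^ 2 ∂μ) * ∫⁻ x, g x ^ 2 ∂μ := by
  have h := ENNReal.lintegral_mul_le_Lp_mul_Lq μ Real.HolderConjugate.two_two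
    hf.aemeasurable hg.aemeasurable
  have h2 := pow_le_pow_left' h 2
  simp only [Pi.mul_apply, ENNReal.rpow_two] at h2
  refine h2.trans (le_of_eq ?_)
  rw [mul_pow, ← ENNReal.rpow_natCast, ← ENNReal.rpow_natCast, ← ENNReal.rpow_mul,
    ← ENNReal.rpow_mul]
  norm_num

theorem ENNReal.sqrt_sq (x : ℝ≥0∞) : (x ^ (1 / 2 : ℝ)) ^ 2 = x := by
  rw [← ENNReal.rpow_natCast, ← ENNReal.rpow_mul]
  norm_num

theorem ENNReal.add_sq_le_two_mul (a b : ℝ≥0∞) : (a + b) ^ 2 ≤ 2 * (a ^ 2 + b ^ 2) := by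
  rcases eq_or_ne a ∞ with rfl | ha
  · simp
  rcases eq_or_ne b ∞ with rfl | hb
  · simp
  lift a to NNReal using ha
  lift b to NNReal using hb
  have := add_sq_le (a := a) (b := b)
  exact_mod_cast this

section Convolution

variable {E : Type*} [MeasurableSpace E] [AddCommGroup E] [MeasurableAdd₂ E] [MeasurableNeg E]

/-- The part of the convolution of `f` and `g` carried by the pairs in `A`. -/
noncomputable def restrictedConv (μ : Measure E) (A : Set (E × E)) (f g : E → ℝ≥0∞) (ξ : E) :
    ℝ≥0∞ :=
  ∫⁻ η, A.indicator (fun p => f p.1 * g p.2) (ξ - η, η) ∂μ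

variable {μ : Measure E} {A : Set (E × E)} {W f g : E → ℝ≥0∞} {H : E → E → ℝ≥0∞}
  {K : ℝ≥0∞}

theorem sqrt_mul_restrictedConv_le (hf : Measurable f) (hg : Measurable g) (hA : MeasurableSet A)
    (hk : ∀ ξ η, (ξ - η, η) ∈ A → W ξ ≤ H ξ η * (W (ξ - η) * W η)) (ξ : E) :
    W ξ ^ (1 / 2 : ℝ) * restrictedConv μ A f g ξ ≤
      ∫⁻ η, H ξ η ^ (1 / 2 : ℝ) *
        ((W (ξ - η) ^ (1 / 2 : ℝ) * f (ξ - η)) * (W η ^ (1 / 2 : ℝ) * g η)) ∂μ := by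
  have h : Measurable (A.indicator (fun p : E × E => f p.1 * g p.2)) :=
    Measurable.indicator (by fun_prop) hA
  have hξ : Measurable fun η : E => A.indicator (fun p : E × E => f p.1 * g p.2) (ξ - η, η) :=
    h.comp (by fun_prop)
  rw [restrictedConv, ← lintegral_const_mul _ hξ]
  refine lintegral_mono fun η => ?_
  by_cases hm : (ξ - η, η) ∈ A
  · rw [Set.indicator_of_mem hm]
    have := ENNReal.rpow_le_rpow (hk ξ η hm) (by norm_num : (0 : ℝ) ≤ 1 / 2)
    rw [ENNReal.mul_rpow_of_nonneg _ _ (by norm_num), ENNReal.mul_rpow_of_nonneg _ _ (by norm_num)]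
      at this
    calc _ ≤ _ := mul_le_mul_left this _
      _ = _ := by ring
  · rw [Set.indicator_of_notMem hm]
    simp

theorem lintegral_mul_le_restrictedConv_add [μ.IsAddLeftInvariant] [μ.IsNegInvariant]
    (hf : Measurable f) (hg : Measurable g) (hA : MeasurableSet A) {ξ : E}
    (hcov : ∀ᵐ η ∂μ, (ξ - η, η) ∈ A ∨ (η, ξ - η) ∈ A) :
    ∫⁻ η, f (ξ - η) * g η ∂μ ≤ restrictedConv μ A f g ξ + restrictedConv μ A g f ξ := by
  have h : Measurable (A.indicator (fun p : E × E => f p.1 * g p.2)) :=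
    Measurable.indicator (by fun_prop) hA
  have hξ : Measurable fun η : E => A.indicator (fun p : E × E => f p.1 * g p.2) (ξ - η, η) :=
    h.comp (by fun_prop)
  have e : restrictedConv μ A g f ξ =
      ∫⁻ η, A.indicator (fun p => g p.1 * f p.2) (η, ξ - η) ∂μ := by
    rw [restrictedConv, ← lintegral_sub_left_eq_self _ ξ]
    simp
  rw [e, restrictedConv, ← lintegral_add_left hξ]
  refine lintegral_mono_ae ?_
  filter_upwards [hcov] with η hη
  rcases hη with hη | hη
  · rw [Set.indicator_of_mem hη]
    exact le_self_add
  · rw [Set.indicator_of_mem hη, mul_comm]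
    exact le_add_self

theorem restrictedConv_union_le {A₁ A₂ : Set (E × E)} (hA₁ : MeasurableSet A₁)
    (hf : Measurable f) (hg : Measurable g) (ξ : E) :
    restrictedConv μ (A₁ ∪ A₂) f g ξ ≤ restrictedConv μ A₁ f g ξ + restrictedConv μ A₂ f g ξ := by
  have h : Measurable (A₁.indicator (fun p : E × E => f p.1 * g p.2)) :=
    Measurable.indicator (by fun_prop) hA₁
  have hξ : Measurable fun η : E => A₁.indicator (fun p : E × E => f p.1 * g p.2) (ξ - η, η) :=
    h.comp (by fun_prop)
  rw [restrictedConv, restrictedConv, restrictedConv, ← lintegral_add_left hξ]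
  refine lintegral_mono fun η => ?_
  by_cases h₁ : (ξ - η, η) ∈ A₁
  · rw [Set.indicator_of_mem h₁, Set.indicator_of_mem (Set.mem_union_left _ h₁)]
    exact le_self_add
  by_cases h₂ : (ξ - η, η) ∈ A₂
  · rw [Set.indicator_of_mem h₂, Set.indicator_of_mem (Set.mem_union_right _ h₂)]
    exact le_add_self
  · rw [Set.indicator_of_notMem (by simp [h₁, h₂])]
    exact zero_le

variable [SFinite μ]

theorem measurable_restrictedConv (hA : MeasurableSet A) (hf : Measurable f) (hg : Measurable g) :
    Measurable (restrictedConv μ A f g) := by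
  have h : Measurable (A.indicator (fun p : E × E => f p.1 * g p.2)) :=
    Measurable.indicator (by fun_prop) hA
  exact (h.comp (by fun_prop : Measurable fun p : E × E => (p.1 - p.2, p.2))).lintegral_prod_right'

theorem lintegral_lintegral_sub_mul [μ.IsAddRightInvariant] {u v : E → ℝ≥0∞} (hu : Measurable u)
    (hv : Measurable v) :
    ∫⁻ ξ, ∫⁻ η, u (ξ - η) * v η ∂μ ∂μ = (∫⁻ ξ, u ξ ∂μ) * ∫⁻ η, v η ∂μ := by
  rw [lintegral_lintegral_swap (by fun_prop), ← lintegral_const_mul _ hv]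
  congr 1 with η
  rw [lintegral_mul_const _ (by fun_prop), lintegral_sub_right_eq_self u η]

theorem lintegral_sq_restrictedConv_le_of_lintegral_right [μ.IsAddRightInvariant]
    (hW : Measurable W) (hf : Measurable f) (hg : Measurable g)
    (hH : Measurable (Function.uncurry H)) (hA : MeasurableSet A)
    (hk : ∀ ξ η, (ξ - η, η) ∈ A → W ξ ≤ H ξ η * (W (ξ - η) * W η))
    (hK : ∀ ξ, ∫⁻ η, H ξ η ∂μ ≤ K) :
    ∫⁻ ξ, W ξ * restrictedConv μ A f g ξ ^ 2 ∂μ ≤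
      K * ((∫⁻ ξ, W ξ * f ξ ^ 2 ∂μ) * ∫⁻ ξ, W ξ * g ξ ^ 2 ∂μ) := by
  rw [← lintegral_lintegral_sub_mul (by fun_prop) (by fun_prop),
    ← lintegral_const_mul _ (by fun_prop)]
  refine lintegral_mono fun ξ => ?_
  have h1 := pow_le_pow_left' (sqrt_mul_restrictedConv_le (μ := μ) hf hg hA hk ξ) 2
  rw [mul_pow, ENNReal.sqrt_sq] at h1
  have hHξ : Measurable (H ξ) := hH.comp (by fun_prop : Measurable fun η : E => (ξ, η))
  refine h1.trans ((lintegral_mul_sq_le μ (by fun_prop) (by fun_prop)).trans ?_)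
  simp only [mul_pow, ENNReal.sqrt_sq]
  gcongr
  exact hK ξ

theorem lintegral_sq_kernel_le [μ.IsAddLeftInvariant] [μ.IsNegInvariant] {k : E → E → ℝ≥0∞} {u v : E → ℝ≥0∞}
    {B : Set E} (hk : Measurable (Function.uncurry k)) (hu : Measurable u) (hv : Measurable v)
    (hB : MeasurableSet B) (hμB : μ B ≠ ∞) (hK : ∀ η, ∫⁻ ξ, k ξ η ^ 2 ∂μ ≤ K) :
    ∫⁻ ξ in B, (∫⁻ η, k ξ η * (u (ξ - η) * v η) ∂μ) ^ 2 ∂μ ≤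
      K * ((∫⁻ ξ, u ξ ^ 2 ∂μ) * ∫⁻ ξ, v ξ ^ 2 ∂μ) := by
  have hkm : Measurable fun p : E × E => k p.1 p.2 := hk
  set h : E → ℝ≥0∞ := fun ξ => ∫⁻ η, k ξ η * (u (ξ - η) * v η) ∂μ with hh
  have hm : Measurable h := by
    have : Measurable fun p : E × E => k p.1 p.2 * (u (p.1 - p.2) * v p.2) := by fun_prop
    exact this.lintegral_prod_right'
  set w : ℕ → E → ℝ≥0∞ := fun n => B.indicator fun ξ => min (h ξ) n with hw
  have hwm : ∀ n, Measurable (w n) := fun n => (hm.min measurable_const).indicator hB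
  have key : ∀ n, ∫⁻ ξ, w n ξ ^ 2 ∂μ ≤ K * ((∫⁻ ξ, u ξ ^ 2 ∂μ) * ∫⁻ ξ, v ξ ^ 2 ∂μ) := by
    intro n
    set I := ∫⁻ ξ, w n ξ ^ 2 ∂μ with hI
    have hIfin : I ≠ ∞ := by
      have : I ≤ ∫⁻ ξ, B.indicator (fun _ => (n : ℝ≥0∞) ^ 2) ξ ∂μ := by
        refine lintegral_mono fun ξ => ?_
        by_cases hξ : ξ ∈ B
        · simp only [hw, Set.indicator_of_mem hξ]
          gcongr
          exact min_le_right _ _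
        · simp [hw, Set.indicator_of_notMem hξ]
      rw [lintegral_indicator_const hB] at this
      exact ne_top_of_le_ne_top (ENNReal.mul_ne_top (by simp) hμB) this
    have h1 : I ≤ ∫⁻ η, v η * ∫⁻ ξ, k ξ η * (w n ξ * u (ξ - η)) ∂μ ∂μ := by
      have e : ∫⁻ η, v η * ∫⁻ ξ, k ξ η * (w n ξ * u (ξ - η)) ∂μ ∂μ = ∫⁻ ξ, w n ξ * h ξ ∂μ := by
        have hwn := hwm n
        calc _ = ∫⁻ η, ∫⁻ ξ, w n ξ * (k ξ η * (u (ξ - η) * v η)) ∂μ ∂μ := by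
              congr 1 with η
              rw [← lintegral_const_mul _ (by fun_prop)]
              congr 1 with ξ
              ring
          _ = _ := by
              rw [lintegral_lintegral_swap (by fun_prop)]
              congr 1 with ξ
              rw [lintegral_const_mul _ (by fun_prop)]
      rw [e]
      refine lintegral_mono fun ξ => ?_
      rw [sq]
      gcongr
      by_cases hξ : ξ ∈ B
      · simp only [hw, Set.indicator_of_mem hξ]
        exact min_le_left _ _
      · simp [hw, Set.indicator_of_notMem hξ]
    have hwn := hwm n
    have h2 : I ^ 2 ≤ (∫⁻ ξ, v ξ ^ 2 ∂μ) * (K * (I * ∫⁻ ξ, u ξ ^ 2 ∂μ)) := by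
      refine (pow_le_pow_left' h1 2).trans ((lintegral_mul_sq_le μ hv ?_).trans ?_)
      · have : Measurable fun p : E × E => k p.1 p.2 * (w n p.1 * u (p.1 - p.2)) := by fun_prop
        exact this.lintegral_prod_left'
      · gcongr
        calc _ ≤ ∫⁻ η, K * ∫⁻ ξ, w n ξ ^ 2 * u (ξ - η) ^ 2 ∂μ ∂μ := by
              refine lintegral_mono fun η => ?_
              refine (lintegral_mul_sq_le μ (by fun_prop) (by fun_prop)).trans ?_
              simp only [mul_pow]
              gcongr
              exact hK η
          _ = _ := by
              rw [lintegral_const_mul _ (by fun_prop), lintegral_lintegral_swap (by fun_prop),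
                ← lintegral_mul_const _ (by fun_prop)]
              congr 2 with ξ
              rw [lintegral_const_mul _ (by fun_prop),
                lintegral_sub_left_eq_self (fun y => u y ^ 2) ξ]
    by_cases hI0 : I = 0
    · simp [hI0]
    · have h3 : I * I ≤ I * (K * ((∫⁻ ξ, u ξ ^ 2 ∂μ) * ∫⁻ ξ, v ξ ^ 2 ∂μ)) := by
        rw [← sq]
        exact h2.trans (le_of_eq (by ring))
      exact (ENNReal.mul_le_mul_iff_right hI0 hIfin).1 h3
  have hlim : ∫⁻ ξ in B, h ξ ^ 2 ∂μ = ⨆ n, ∫⁻ ξ, w n ξ ^ 2 ∂μ := by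
    rw [← lintegral_indicator hB, ← lintegral_iSup]
    · congr 1 with ξ
      by_cases hξ : ξ ∈ B
      · simp only [hw, Set.indicator_of_mem hξ]
        have : h ξ = ⨆ n : ℕ, min (h ξ) n := by
          rw [← inf_iSup_eq, ENNReal.iSup_natCast, inf_top_eq]
        conv_lhs => rw [this]
        exact ENNReal.iSup_pow (fun n : ℕ => min (h ξ) n) 2
      · simp [hw, Set.indicator_of_notMem hξ]
    · intro n
      have := hwm n
      fun_prop
    · intro n m hnm ξ
      simp only [hw]
      gcongr ?_ ^ 2
      refine Set.indicator_le_indicator ?_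
      gcongr
  rw [hlim]
  exact iSup_le key

theorem lintegral_sq_restrictedConv_le_of_lintegral_left [μ.IsAddLeftInvariant] [μ.IsNegInvariant]
    {B : Set E} (hW : Measurable W) (hf : Measurable f) (hg : Measurable g)
    (hH : Measurable (Function.uncurry H)) (hA : MeasurableSet A)
    (hB : MeasurableSet B) (hμB : μ B ≠ ∞) (hAB : ∀ ξ η, (ξ - η, η) ∈ A → ξ ∈ B)
    (hk : ∀ ξ η, (ξ - η, η) ∈ A → W ξ ≤ H ξ η * (W (ξ - η) * W η))
    (hK : ∀ η, ∫⁻ ξ, H ξ η ∂μ ≤ K) :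
    ∫⁻ ξ, W ξ * restrictedConv μ A f g ξ ^ 2 ∂μ ≤
      K * ((∫⁻ ξ, W ξ * f ξ ^ 2 ∂μ) * ∫⁻ ξ, W ξ * g ξ ^ 2 ∂μ) := by
  have h := lintegral_sq_kernel_le (μ := μ) (K := K) (k := fun ξ η => H ξ η ^ (1 / 2 : ℝ))
    (u := fun ξ => W ξ ^ (1 / 2 : ℝ) * f ξ) (v := fun ξ => W ξ ^ (1 / 2 : ℝ) * g ξ)
    (B := B) (hH.pow_const _) (by fun_prop) (by fun_prop) hB hμB
    (by simpa only [ENNReal.sqrt_sq] using hK)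
  simp only [mul_pow, ENNReal.sqrt_sq] at h
  refine le_trans ?_ h
  rw [← lintegral_indicator hB]
  refine lintegral_mono fun ξ => ?_
  by_cases hξ : ξ ∈ B
  · rw [Set.indicator_of_mem hξ]
    have h1 := pow_le_pow_left' (sqrt_mul_restrictedConv_le (μ := μ) hf hg hA hk ξ) 2
    rwa [mul_pow, ENNReal.sqrt_sq] at h1
  · have : restrictedConv μ A f g ξ = 0 := by
      have : ∀ η, A.indicator (fun p => f p.1 * g p.2) (ξ - η, η) = 0 := fun η =>
        Set.indicator_of_notMem (fun hm => hξ (hAB ξ η hm)) _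
      simp [restrictedConv, this]
    simp [this]

/-- Boundedness of convolution on a weighted space, from kernel bounds on two regions. -/
theorem lintegral_sq_conv_le [μ.IsAddLeftInvariant] [μ.IsAddRightInvariant] [μ.IsNegInvariant]
    {A₁ A₂ : Set (E × E)} {H₁ H₂ : E → E → ℝ≥0∞} {K₁ K₂ : ℝ≥0∞}
    {B : Set E} (hW : Measurable W) (hf : Measurable f) (hg : Measurable g)
    (hH₁ : Measurable (Function.uncurry H₁)) (hH₂ : Measurable (Function.uncurry H₂))
    (hA₁ : MeasurableSet A₁) (hA₂ : MeasurableSet A₂)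
    (hB : MeasurableSet B) (hμB : μ B ≠ ∞) (hAB : ∀ ξ η, (ξ - η, η) ∈ A₂ → ξ ∈ B)
    (hk₁ : ∀ ξ η, (ξ - η, η) ∈ A₁ → W ξ ≤ H₁ ξ η * (W (ξ - η) * W η))
    (hk₂ : ∀ ξ η, (ξ - η, η) ∈ A₂ → W ξ ≤ H₂ ξ η * (W (ξ - η) * W η))
    (hK₁ : ∀ ξ, ∫⁻ η, H₁ ξ η ∂μ ≤ K₁) (hK₂ : ∀ η, ∫⁻ ξ, H₂ ξ η ∂μ ≤ K₂)
    (hcov : ∀ᵐ ξ ∂μ, ∀ᵐ η ∂μ, (ξ - η, η) ∈ A₁ ∪ A₂ ∨ (η, ξ - η) ∈ A₁ ∪ A₂) :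
    ∫⁻ ξ, W ξ * (∫⁻ η, f (ξ - η) * g η ∂μ) ^ 2 ∂μ ≤
      8 * (K₁ + K₂) * ((∫⁻ ξ, W ξ * f ξ ^ 2 ∂μ) * ∫⁻ ξ, W ξ * g ξ ^ 2 ∂μ) := by
  have b₁ : ∀ {f g : E → ℝ≥0∞}, Measurable f → Measurable g → _ := fun {f g} hf hg =>
    lintegral_sq_restrictedConv_le_of_lintegral_right hW hf hg hH₁ hA₁ hk₁ hK₁
  have b₂ : ∀ {f g : E → ℝ≥0∞}, Measurable f → Measurable g → _ := fun {f g} hf hg =>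
    lintegral_sq_restrictedConv_le_of_lintegral_left hW hf hg hH₂ hA₂ hB hμB hAB hk₂ hK₂
  have m₁ : ∀ {f g : E → ℝ≥0∞}, Measurable f → Measurable g → _ := fun {f g} hf hg =>
    measurable_restrictedConv (μ := μ) hA₁ hf hg
  have m₂ : ∀ {f g : E → ℝ≥0∞}, Measurable f → Measurable g → _ := fun {f g} hf hg =>
    measurable_restrictedConv (μ := μ) hA₂ hf hg
  have m₁fg := m₁ hf hg
  have m₁gf := m₁ hg hf
  have m₂fg := m₂ hf hg
  have m₂gf := m₂ hg hf
  calc _ ≤ ∫⁻ ξ, 4 * (W ξ * restrictedConv μ A₁ f g ξ ^ 2 + W ξ * restrictedConv μ A₂ f g ξ ^ 2 +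
        (W ξ * restrictedConv μ A₁ g f ξ ^ 2 + W ξ * restrictedConv μ A₂ g f ξ ^ 2)) ∂μ := by
        refine lintegral_mono_ae ?_
        filter_upwards [hcov] with ξ hξ
        have h1 := lintegral_mul_le_restrictedConv_add hf hg (hA₁.union hA₂) hξ
        have h2 := h1.trans (add_le_add
          (restrictedConv_union_le hA₁ hf hg ξ) (restrictedConv_union_le hA₁ hg hf ξ))
        calc _ ≤ W ξ * (2 * (2 * (restrictedConv μ A₁ f g ξ ^ 2 + restrictedConv μ A₂ f g ξ ^ 2) +
              2 * (restrictedConv μ A₁ g f ξ ^ 2 + restrictedConv μ A₂ g f ξ ^ 2))) := by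
              gcongr
              refine (pow_le_pow_left' h2 2).trans ((ENNReal.add_sq_le_two_mul _ _).trans ?_)
              gcongr <;> exact ENNReal.add_sq_le_two_mul _ _
          _ = _ := by ring
    _ = 4 * ((∫⁻ ξ, W ξ * restrictedConv μ A₁ f g ξ ^ 2 ∂μ) +
        (∫⁻ ξ, W ξ * restrictedConv μ A₂ f g ξ ^ 2 ∂μ) +
        ((∫⁻ ξ, W ξ * restrictedConv μ A₁ g f ξ ^ 2 ∂μ) +
        (∫⁻ ξ, W ξ * restrictedConv μ A₂ g f ξ ^ 2 ∂μ))) := by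
        rw [lintegral_const_mul _ (by fun_prop), lintegral_add_left (by fun_prop),
          lintegral_add_left (by fun_prop), lintegral_add_left (by fun_prop)]
    _ ≤ 4 * (K₁ * ((∫⁻ ξ, W ξ * f ξ ^ 2 ∂μ) * ∫⁻ ξ, W ξ * g ξ ^ 2 ∂μ) +
        K₂ * ((∫⁻ ξ, W ξ * f ξ ^ 2 ∂μ) * ∫⁻ ξ, W ξ * g ξ ^ 2 ∂μ) +
        (K₁ * ((∫⁻ ξ, W ξ * g ξ ^ 2 ∂μ) * ∫⁻ ξ, W ξ * f ξ ^ 2 ∂μ) +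
        K₂ * ((∫⁻ ξ, W ξ * g ξ ^ 2 ∂μ) * ∫⁻ ξ, W ξ * f ξ ^ 2 ∂μ))) := by
        gcongr
        exacts [b₁ hf hg, b₂ hf hg, b₁ hg hf, b₂ hg hf]
    _ = _ := by ring

end Convolution

/-- The last `n` coordinates of a vector. -/
def tailVec {n : ℕ} (x : EuclideanSpace ℝ (Fin (n + 1))) : EuclideanSpace ℝ (Fin n) :=
  WithLp.toLp 2 fun i => x i.succ

section Tail

variable {n : ℕ}

theorem tailVec_sub (x y : EuclideanSpace ℝ (Fin (n + 1))) :
    tailVec (x - y) = tailVec x - tailVec y := rfl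

@[fun_prop]
theorem measurable_tailVec : Measurable (tailVec (n := n)) := by
  unfold tailVec
  fun_prop

theorem norm_sq_eq_add_tailVec (x : EuclideanSpace ℝ (Fin (n + 1))) :
    ‖x‖ ^ 2 = |x 0| ^ 2 + ‖tailVec x‖ ^ 2 := by
  simp [EuclideanSpace.norm_sq_eq, Fin.sum_univ_succ, tailVec]

theorem norm_tailVec_le (x : EuclideanSpace ℝ (Fin (n + 1))) : ‖tailVec x‖ ≤ ‖x‖ := by
  have := norm_sq_eq_add_tailVec x
  exact (sq_le_sq₀ (norm_nonneg _) (norm_nonneg _)).1 (by nlinarith [sq_nonneg |x 0|])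

theorem abs_head_le (x : EuclideanSpace ℝ (Fin (n + 1))) : |x 0| ≤ ‖x‖ := by
  simpa using PiLp.norm_apply_le x 0

theorem lintegral_head_mul_tail {φ : ℝ → ℝ≥0∞} {ψ : EuclideanSpace ℝ (Fin n) → ℝ≥0∞}
    (hφ : Measurable φ) (hψ : Measurable ψ) :
    ∫⁻ x : EuclideanSpace ℝ (Fin (n + 1)), φ (x 0) * ψ (tailVec x) =
      (∫⁻ t, φ t) * ∫⁻ y, ψ y := by
  have h1 := (PiLp.volume_preserving_ofLp (Fin (n + 1))).lintegral_comp
    (f := fun x : Fin (n + 1) → ℝ => φ (x 0) * ψ (WithLp.toLp 2 fun i => x i.succ)) (by fun_prop)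
  have h2 := (volume_preserving_piFinSuccAbove (fun _ : Fin (n + 1) => ℝ) 0).lintegral_comp
    (f := fun p : ℝ × (Fin n → ℝ) => φ p.1 * ψ (WithLp.toLp 2 p.2)) (by fun_prop)
  have h3 := (PiLp.volume_preserving_toLp (Fin n)).lintegral_comp hψ
  rw [← h3, ← lintegral_prod_mul hφ.aemeasurable (by fun_prop)]
  exact h1.trans h2

theorem ae_head_ne_zero_and_tail_ne_zero (hn : 1 ≤ n) :
    ∀ᵐ x : EuclideanSpace ℝ (Fin (n + 1)), x 0 ≠ 0 ∧ tailVec x ≠ 0 := by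
  have key : ∀ i, ∀ᵐ x : EuclideanSpace ℝ (Fin (n + 1)), x i ≠ 0 := by
    intro i
    have := Measure.addHaar_submodule (volume : Measure (EuclideanSpace ℝ (Fin (n + 1))))
      (LinearMap.ker (EuclideanSpace.proj (𝕜 := ℝ) i).toLinearMap) (by
        intro h
        have : EuclideanSpace.single i (1 : ℝ) ∈
          LinearMap.ker (EuclideanSpace.proj (𝕜 := ℝ) i).toLinearMap := h ▸ Submodule.mem_top
        simp at this)
    have e : {x : EuclideanSpace ℝ (Fin (n + 1)) | x i = 0} =
        LinearMap.ker (EuclideanSpace.proj (𝕜 := ℝ) i).toLinearMap := by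
      ext x
      simp
    simpa [ae_iff, e] using this
  obtain ⟨m, rfl⟩ : ∃ m, n = m + 1 := ⟨n - 1, by omega⟩
  filter_upwards [key 0, key 1] with x h0 h1
  refine ⟨h0, fun h => h1 ?_⟩
  exact congrArg (fun y => y 0) h

end Tail

section Powers

/-- The power `‖y‖ ^ (-b)` on the ball of radius `M`, extended by zero. -/
noncomputable def ballPow {E : Type*} [Norm E] (M b : ℝ) (y : E) : ℝ≥0∞ :=
  if ‖y‖ < M then ENNReal.ofReal (‖y‖ ^ (-b)) else 0

@[fun_prop]
theorem measurable_ballPow {E : Type*} [NormedAddCommGroup E] [MeasurableSpace E]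
    [OpensMeasurableSpace E] (M b : ℝ) : Measurable (ballPow (E := E) M b) :=
  Measurable.ite (measurableSet_lt measurable_norm measurable_const) (by fun_prop) measurable_const

variable {E : Type*} [NormedAddCommGroup E] [NormedSpace ℝ E] [FiniteDimensional ℝ E]
  [MeasurableSpace E] [BorelSpace E]

theorem lintegral_ballPow_ne_top (μ : Measure E) [μ.IsAddHaarMeasure]
    (hE : 1 ≤ Module.finrank ℝ E) (M : ℝ) {b : ℝ} (hb : b < Module.finrank ℝ E) :
    ∫⁻ y, ballPow M b y ∂μ ≠ ∞ := by
  have h := integrableOn_ball_of_norm_le_rpow (μ := μ) hE (f := fun y : E => ‖y‖ ^ (-b))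
    (C := 1) (r := M) hb (.of_forall fun y => by simp [abs_of_nonneg, Real.rpow_nonneg])
    (Measurable.aestronglyMeasurable (by fun_prop))
  have h2 := h.lintegral_lt_top
  rw [← lintegral_indicator measurableSet_ball] at h2
  refine ne_top_of_le_ne_top h2.ne (lintegral_mono fun y => ?_)
  by_cases hy : ‖y‖ < M <;> simp [ballPow, hy]

theorem lintegral_one_add_norm_sq_rpow_neg_ne_top (μ : Measure E) [μ.IsAddHaarMeasure] {s : ℝ}
    (hs : (Module.finrank ℝ E : ℝ) < 2 * s) :
    ∫⁻ y, ENNReal.ofReal ((1 + ‖y‖ ^ 2) ^ (-s)) ∂μ ≠ ∞ := by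
  have h := (integrable_rpow_neg_one_add_norm_sq (μ := μ) hs).lintegral_lt_top.ne
  convert h using 5
  ring

theorem lintegral_eq_of_comp_smul_eq (μ : Measure E) [μ.IsAddHaarMeasure] {f g : E → ℝ≥0∞}
    (hf : Measurable f) (hg : Measurable g) {a c : ℝ} (ha : 0 < a)
    (hfg : ∀ y, f (a • y) = ENNReal.ofReal c * g y) :
    ∫⁻ y, f y ∂μ = ENNReal.ofReal (a ^ Module.finrank ℝ E * c) * ∫⁻ y, g y ∂μ := by
  have h : ∫⁻ y, f (a • y) ∂μ =
      ENNReal.ofReal (a ^ Module.finrank ℝ E)⁻¹ * ∫⁻ y, f y ∂μ := by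
    rw [← lintegral_map hf (by fun_prop), Measure.map_addHaar_smul μ ha.ne',
      lintegral_smul_measure, abs_of_pos (by positivity), smul_eq_mul]
  simp_rw [hfg, lintegral_const_mul _ hg] at h
  rw [ENNReal.ofReal_mul (by positivity), mul_assoc, h, ← mul_assoc,
    ← ENNReal.ofReal_mul (by positivity), mul_inv_cancel₀ (by positivity), ENNReal.ofReal_one,
    one_mul]

end Powers

section Kernels

variable {n : ℕ}

theorem lintegral_head_sub_mul_tail {φ : ℝ → ℝ≥0∞} {ψ : EuclideanSpace ℝ (Fin n) → ℝ≥0∞}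
    (hφ : Measurable φ) (hψ : Measurable ψ) (c : ℝ) :
    ∫⁻ x : EuclideanSpace ℝ (Fin (n + 1)), φ (x 0 - c) * ψ (tailVec x) =
      (∫⁻ t, φ t) * ∫⁻ y, ψ y := by
  rw [lintegral_head_mul_tail (φ := fun t => φ (t - c)) (by fun_prop) hψ,
    lintegral_sub_right_eq_self φ c]

theorem lintegral_head_mul_sub_tail {φ : ℝ → ℝ≥0∞} {ψ : EuclideanSpace ℝ (Fin n) → ℝ≥0∞}
    (hφ : Measurable φ) (hψ : Measurable ψ) (ξ : EuclideanSpace ℝ (Fin (n + 1))) :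
    ∫⁻ η : EuclideanSpace ℝ (Fin (n + 1)), φ (η 0) * ψ (tailVec (ξ - η)) =
      (∫⁻ t, φ t) * ∫⁻ y, ψ y := by
  simp_rw [tailVec_sub]
  rw [lintegral_head_mul_tail (ψ := fun y => ψ (tailVec ξ - y)) hφ (by fun_prop),
    lintegral_sub_left_eq_self ψ]

/-- The scale-invariant kernel controlling the planar interaction. -/
noncomputable def planarKernel (r : ℝ) (ξ η : EuclideanSpace ℝ (Fin (n + 1))) : ℝ≥0∞ :=
  ballPow (4 * |η 0|) (2 - 2 * r) (ξ 0 - η 0) *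
    ENNReal.ofReal ((|η 0| ^ 2 + ‖tailVec ξ‖ ^ 2) ^ (-r))

theorem measurable_planarKernel (r : ℝ) :
    Measurable (Function.uncurry (planarKernel (n := n) r)) := by
  unfold planarKernel ballPow
  refine Measurable.mul (Measurable.ite (measurableSet_lt ?_ ?_) ?_ measurable_const) ?_ <;>
  fun_prop

theorem lintegral_planarKernel_le {r : ℝ} (η : EuclideanSpace ℝ (Fin 2)) :
    ∫⁻ ξ, planarKernel r ξ η ≤ (∫⁻ t : ℝ, ballPow 4 (2 - 2 * r) t) *
      ∫⁻ y : EuclideanSpace ℝ (Fin 1), ENNReal.ofReal ((1 + ‖y‖ ^ 2) ^ (-r)) := by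
  rcases eq_or_ne (η 0) 0 with h0 | h0
  · have : ∀ ξ, planarKernel r ξ η = 0 := fun ξ => by
      simp [planarKernel, ballPow, h0, not_lt.2 (abs_nonneg (ξ 0))]
    simp [this]
  set a := |η 0| with ha
  have hapos : 0 < a := abs_pos.2 h0
  unfold planarKernel
  rw [← ha, lintegral_head_sub_mul_tail (φ := ballPow (4 * a) (2 - 2 * r))
    (ψ := fun y => ENNReal.ofReal ((a ^ 2 + ‖y‖ ^ 2) ^ (-r))) (by fun_prop) (by fun_prop),
    lintegral_eq_of_comp_smul_eq (f := ballPow (4 * a) (2 - 2 * r)) volume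
      (g := ballPow 4 (2 - 2 * r)) (by fun_prop) (by fun_prop) (c := a ^ (-(2 - 2 * r))) hapos,
    lintegral_eq_of_comp_smul_eq volume
      (f := fun y : EuclideanSpace ℝ (Fin 1) => ENNReal.ofReal ((a ^ 2 + ‖y‖ ^ 2) ^ (-r)))
      (g := fun y => ENNReal.ofReal ((1 + ‖y‖ ^ 2) ^ (-r))) (by fun_prop) (by fun_prop)
      (c := a ^ (-(2 * r))) hapos]
  · rw [mul_mul_mul_comm, ← ENNReal.ofReal_mul (by positivity)]
    have : a ^ Module.finrank ℝ ℝ * a ^ (-(2 - 2 * r)) *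
        (a ^ Module.finrank ℝ (EuclideanSpace ℝ (Fin 1)) * a ^ (-(2 * r))) = 1 := by
      simp only [Module.finrank_self, finrank_euclideanSpace, Fintype.card_fin, pow_one]
      nth_rewrite 1 [← Real.rpow_one a]
      nth_rewrite 3 [← Real.rpow_one a]
      rw [← Real.rpow_add hapos, ← Real.rpow_add hapos, ← Real.rpow_add hapos]
      ring_nf
      simp
    rw [this]
    simp
  · intro y
    rw [← ENNReal.ofReal_mul (by positivity), norm_smul, Real.norm_of_nonneg hapos.le,
      (by ring : a ^ 2 + (a * ‖y‖) ^ 2 = a ^ 2 * (1 + ‖y‖ ^ 2)),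
      Real.mul_rpow (by positivity) (by positivity), ← Real.rpow_natCast, ← Real.rpow_mul hapos.le]
    norm_num
  · intro y
    have h1 : |a * y| < 4 * a ↔ |y| < 4 := by
      rw [abs_mul, abs_of_pos hapos, mul_comm 4 a]
      exact mul_lt_mul_iff_right₀ hapos
    by_cases hy : |y| < 4
    · simp only [ballPow, smul_eq_mul, Real.norm_eq_abs, h1, hy, if_true]
      rw [← ENNReal.ofReal_mul (by positivity), abs_mul, abs_of_pos hapos,
        Real.mul_rpow hapos.le (abs_nonneg y)]
    · simp only [ballPow, smul_eq_mul, Real.norm_eq_abs, h1, hy, if_false, mul_zero]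

end Kernels

section Weight

theorem rpow_mul_rpow_two_sub_le {x y p : ℝ} (hx : 0 < x) (hy : 0 < y) (hp : 0 ≤ p) (hp2 : p ≤ 2) :
    x ^ p * y ^ (2 - p) ≤ x ^ 2 + y ^ 2 := by
  rcases le_total x y with h | h
  · calc x ^ p * y ^ (2 - p) ≤ y ^ p * y ^ (2 - p) := by gcongr
      _ = y ^ 2 := by rw [← Real.rpow_add hy, add_sub_cancel, Real.rpow_two]
      _ ≤ _ := by nlinarith
  · calc x ^ p * y ^ (2 - p) ≤ x ^ p * x ^ (2 - p) := by
          gcongr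
      _ = x ^ 2 := by rw [← Real.rpow_add hx, add_sub_cancel, Real.rpow_two]
      _ ≤ _ := by nlinarith

/-- The low-frequency weight of a vector of norm `ρ` with first coordinate of size `x`. -/
noncomputable def lowWeight (r δ x ρ : ℝ) : ℝ := (x ^ 2 + ρ ^ (2 * δ)) / ρ ^ (2 * r)

variable {r δ s p b ε x y a t ρ R S : ℝ}

theorem lowWeight_nonneg (hρ : 0 ≤ ρ) : 0 ≤ lowWeight r δ x ρ := by
  unfold lowWeight
  positivity

theorem sq_div_le_lowWeight (hρ : 0 ≤ ρ) : x ^ 2 / ρ ^ (2 * r) ≤ lowWeight r δ x ρ := by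
  unfold lowWeight
  gcongr
  have := Real.rpow_nonneg hρ (2 * δ)
  linarith

theorem rpow_le_lowWeight (hρ : 0 < ρ) : ρ ^ (2 * δ - 2 * r) ≤ lowWeight r δ x ρ := by
  unfold lowWeight
  rw [Real.rpow_sub hρ]
  gcongr
  nlinarith

theorem rpow_mul_rpow_le_lowWeight (hx : 0 < x) (hρ : 0 < ρ) (hp : 0 ≤ p) (hp2 : p ≤ 2) :
    x ^ p * ρ ^ (δ * (2 - p) - 2 * r) ≤ lowWeight r δ x ρ := by
  have h := rpow_mul_rpow_two_sub_le hx (Real.rpow_pos_of_pos hρ δ) hp hp2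
  rw [← Real.rpow_mul hρ.le, ← Real.rpow_natCast (ρ ^ δ), ← Real.rpow_mul hρ.le,
    (by push_cast; ring : δ * ((2 : ℕ) : ℝ) = 2 * δ)] at h
  rw [lowWeight, Real.rpow_sub hρ, ← mul_div_assoc]
  gcongr

theorem one_le_rpow_mul_lowWeight (hx : 0 < x) (ht : 0 < t) (htρ : t ≤ ρ) (hρ1 : ρ < 1)
    (hp : 0 ≤ p) (hp2 : p ≤ 2) (hb : 0 ≤ b) (hpb : δ * (2 - p) - 2 * r ≤ b) :
    1 ≤ x ^ (-p) * t ^ (-b) * lowWeight r δ x ρ := by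
  have hρ := ht.trans_le htρ
  have h1 := rpow_mul_rpow_le_lowWeight (r := r) (δ := δ) hx hρ hp hp2
  have h2 : t ^ b ≤ ρ ^ (δ * (2 - p) - 2 * r) :=
    (Real.rpow_le_rpow ht.le htρ hb).trans
      (Real.rpow_le_rpow_of_exponent_ge hρ hρ1.le hpb)
  calc (1 : ℝ) = x ^ (-p) * t ^ (-b) * (x ^ p * t ^ b) := by
        rw [Real.rpow_neg hx.le, Real.rpow_neg ht.le]
        field_simp
    _ ≤ x ^ (-p) * t ^ (-b) * (x ^ p * ρ ^ (δ * (2 - p) - 2 * r)) := by gcongr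
    _ ≤ _ := by gcongr

/-- Triangle inequality for the numerator of the low-frequency weight. -/
theorem sq_add_rpow_le (hδ : 1 ≤ δ) (ha : 0 ≤ a) (hρ : 0 ≤ ρ) (haxy : a ≤ x + y) (hρR : ρ ≤ 2 * R) :
    a ^ 2 + ρ ^ (2 * δ) ≤ 2 ^ (2 * δ) * (x ^ 2 + R ^ (2 * δ) + y ^ 2) := by
  have h2 : (2 : ℝ) ≤ 2 ^ (2 * δ) := by
    calc (2 : ℝ) = 2 ^ (1 : ℝ) := by simp
      _ ≤ _ := Real.rpow_le_rpow_of_exponent_le (by norm_num) (by linarith)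
  have h3 : ρ ^ (2 * δ) ≤ 2 ^ (2 * δ) * R ^ (2 * δ) := by
    rw [← Real.mul_rpow (by norm_num) (by linarith)]
    gcongr
  nlinarith [sq_nonneg (x - y), sq_nonneg x, sq_nonneg y]

theorem lowWeight_le_of_nonpos (hr : r ≤ 0) (hδ : 1 ≤ δ) (ha : 0 ≤ a) (hρ : 0 < ρ)
    (haxy : a ≤ x + y) (hρR : ρ ≤ 2 * R) (hSR : S ≤ R) (hS1 : S < 1)
    (hx : 0 < x) (ht : 0 < t) (htS : t ≤ S) (hp : 0 ≤ p) (hp2 : p ≤ 2) (hb : 0 ≤ b)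
    (hpb : δ * (2 - p) - 2 * r ≤ b) :
    lowWeight r δ a ρ ≤ 2 ^ (2 * δ - 2 * r) * (lowWeight r δ x R +
      x ^ (-p) * t ^ (-b) * (lowWeight r δ y S * lowWeight r δ x R)) := by
  have hR : 0 < R := by linarith
  have hS : 0 < S := by linarith
  have h1 := sq_add_rpow_le hδ ha hρ.le haxy hρR
  have h2 : ρ ^ (-(2 * r)) ≤ 2 ^ (-(2 * r)) * R ^ (-(2 * r)) := by
    rw [← Real.mul_rpow (by norm_num) hR.le]
    gcongr
    linarith
  have hy2 : y ^ 2 * R ^ (-(2 * r)) ≤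
      x ^ (-p) * t ^ (-b) * (lowWeight r δ y S * lowWeight r δ x R) := by
    have e1 := sq_div_le_lowWeight (r := r) (δ := δ) (x := y) hS.le
    have e2 := rpow_mul_rpow_le_lowWeight (r := r) (δ := δ) hx hR hp hp2
    have e3 : t ^ b ≤ S ^ (-(2 * r)) * R ^ (δ * (2 - p)) := by
      calc t ^ b ≤ S ^ b := by gcongr
        _ ≤ S ^ (δ * (2 - p) - 2 * r) := Real.rpow_le_rpow_of_exponent_ge hS hS1.le hpb
        _ = S ^ (-(2 * r)) * S ^ (δ * (2 - p)) := by rw [← Real.rpow_add hS]; ring_nf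
        _ ≤ _ := by
          gcongr
    have e4 : 0 ≤ R ^ (-(2 * r)) := by positivity
    calc y ^ 2 * R ^ (-(2 * r)) = x ^ (-p) * t ^ (-b) * (x ^ p * t ^ b * (y ^ 2 * R ^ (-(2 * r)))) := by
          rw [Real.rpow_neg hx.le, Real.rpow_neg ht.le]
          field_simp
      _ ≤ x ^ (-p) * t ^ (-b) * (x ^ p * (S ^ (-(2 * r)) * R ^ (δ * (2 - p))) *
            (y ^ 2 * R ^ (-(2 * r)))) := by gcongr
      _ = x ^ (-p) * t ^ (-b) * ((y ^ 2 / S ^ (2 * r)) * (x ^ p * R ^ (δ * (2 - p) - 2 * r))) := by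
          rw [div_eq_mul_inv, ← Real.rpow_neg hS.le,
            (by ring : δ * (2 - p) - 2 * r = δ * (2 - p) + -(2 * r)), Real.rpow_add hR]
          ring
      _ ≤ _ := by gcongr; exact lowWeight_nonneg hS.le
  calc lowWeight r δ a ρ = (a ^ 2 + ρ ^ (2 * δ)) * ρ ^ (-(2 * r)) := by
        rw [lowWeight, div_eq_mul_inv, Real.rpow_neg hρ.le]
    _ ≤ (2 ^ (2 * δ) * (x ^ 2 + R ^ (2 * δ) + y ^ 2)) * (2 ^ (-(2 * r)) * R ^ (-(2 * r))) := by
        gcongr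
    _ = 2 ^ (2 * δ - 2 * r) * (lowWeight r δ x R + y ^ 2 * R ^ (-(2 * r))) := by
        rw [lowWeight, div_eq_mul_inv, Real.rpow_neg hR.le, sub_eq_add_neg,
          Real.rpow_add (by norm_num)]
        ring
    _ ≤ _ := by gcongr

theorem lowWeight_le_add_of_nonneg (hr : 0 ≤ r) (hδ : 1 ≤ δ) (ha : 0 ≤ a) (hρ : 0 < ρ)
    (haxy : a ≤ x + y) (hρR : ρ ≤ 2 * R) (hRρ : R ≤ 5 * ρ) (hS : 0 < S) (hSR : S ≤ R) :
    lowWeight r δ a ρ ≤ 2 ^ (2 * δ) * 5 ^ (2 * r) * (lowWeight r δ x R + lowWeight r δ y S) := by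
  have hR : 0 < R := by linarith
  have h1 := sq_add_rpow_le hδ ha hρ.le haxy hρR
  have h2 : R ^ (2 * r) ≤ 5 ^ (2 * r) * ρ ^ (2 * r) := by
    rw [← Real.mul_rpow (by norm_num) hρ.le]
    gcongr
  have h3 : (ρ ^ (2 * r))⁻¹ ≤ 5 ^ (2 * r) * (R ^ (2 * r))⁻¹ := by
    rw [inv_le_comm₀ (by positivity) (by positivity), mul_inv, inv_inv, inv_mul_le_iff₀ (by positivity)]
    exact h2
  have h4 : y ^ 2 / R ^ (2 * r) ≤ lowWeight r δ y S :=
    le_trans (by gcongr) (sq_div_le_lowWeight hS.le)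
  calc lowWeight r δ a ρ = (a ^ 2 + ρ ^ (2 * δ)) * (ρ ^ (2 * r))⁻¹ := by
        rw [lowWeight, div_eq_mul_inv]
    _ ≤ (2 ^ (2 * δ) * (x ^ 2 + R ^ (2 * δ) + y ^ 2)) * (5 ^ (2 * r) * (R ^ (2 * r))⁻¹) := by
        gcongr
    _ = 2 ^ (2 * δ) * 5 ^ (2 * r) * (lowWeight r δ x R + y ^ 2 / R ^ (2 * r)) := by
        rw [lowWeight]
        ring
    _ ≤ _ := by gcongr

theorem rpow_le_two_rpow_mul {e : ℝ} (hR : 0 < R) (hRS : R ≤ 2 * S) (hSR : S ≤ 2 * R) :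
    R ^ e ≤ 2 ^ |e| * S ^ e := by
  have hS : 0 < S := by linarith
  rcases le_total 0 e with h | h
  · rw [abs_of_nonneg h, ← Real.mul_rpow (by norm_num) hS.le]
    gcongr
  · have : (2 * R) ^ e ≤ S ^ e := Real.rpow_le_rpow_of_nonpos hS hSR h
    rw [Real.mul_rpow (by norm_num) hR.le] at this
    rw [abs_of_nonpos h]
    calc R ^ e = 2 ^ (-e) * (2 ^ e * R ^ e) := by
          rw [← mul_assoc, ← Real.rpow_add (by norm_num)]
          simp
      _ ≤ _ := by gcongr

theorem lowWeight_le_add_sq_div (hδr : r ≤ δ) (hρ : 0 < ρ) (hρR : ρ ≤ R) :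
    lowWeight r δ a ρ ≤ lowWeight r δ x R + a ^ 2 / ρ ^ (2 * r) := by
  have h1 : ρ ^ (2 * δ - 2 * r) ≤ lowWeight r δ x R :=
    le_trans (Real.rpow_le_rpow hρ.le hρR (by linarith)) (rpow_le_lowWeight (hρ.trans_le hρR))
  rw [Real.rpow_sub hρ] at h1
  rw [lowWeight, add_div]
  linarith

theorem sq_div_rpow_le_rpow_mul_lowWeight (ha : 0 < a) (haρ : a ≤ ρ) (hax : a ≤ 2 * x)
    (ht : 0 < t) (htρ : t ≤ ρ) (hρR : ρ ≤ R) (hR1 : R < 1) (hRS : R ≤ 2 * S) (hSR : S ≤ 2 * R)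
    (hy : 0 < y) (hp : 0 ≤ p) (hp2 : p ≤ 2) (hε : 0 ≤ ε) (hε2 : ε ≤ 2) (hb : 0 ≤ b)
    (hb1 : 2 * r - ε ≤ b) (hb2 : δ * (2 - p) - 2 * r + (δ - 1) * ε ≤ b) :
    a ^ 2 / ρ ^ (2 * r) ≤ 4 * 2 ^ |δ * (2 - p) - 2 * r| *
      (y ^ (-p) * t ^ (-b) * (lowWeight r δ y S * lowWeight r δ x R)) := by
  have hx : 0 < x := by linarith
  have hρ : 0 < ρ := by linarith
  have hR : 0 < R := by linarith
  have hS : 0 < S := by linarith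
  set e := δ * (2 - p) - 2 * r with he
  have e1 := rpow_mul_rpow_le_lowWeight (r := r) (δ := δ) (p := 2 - ε) hx hR (by linarith)
    (by linarith)
  have e2 := rpow_mul_rpow_le_lowWeight (r := r) (δ := δ) hy hS hp hp2
  have e3 := rpow_le_two_rpow_mul (e := e) hR hRS hSR
  have e4 : a ^ (2 - ε) ≤ 4 * x ^ (2 - ε) := by
    calc a ^ (2 - ε) ≤ (2 * x) ^ (2 - ε) := by
          gcongr
      _ = 2 ^ (2 - ε) * x ^ (2 - ε) := Real.mul_rpow (by norm_num) hx.le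
      _ ≤ 2 ^ (2 : ℝ) * x ^ (2 - ε) := by
          gcongr
          · norm_num
          · linarith
      _ = _ := by norm_num
  have e5 : ρ ^ (ε - 2 * r + b) ≤ R ^ (δ * ε - 2 * r + e) := by
    rcases le_total (δ * ε - 2 * r + e) 0 with h | h
    · exact (Real.rpow_le_one hρ.le (by linarith) (by linarith)).trans
        (Real.one_le_rpow_of_pos_of_le_one_of_nonpos hR hR1.le h)
    · exact (Real.rpow_le_rpow_of_exponent_ge hρ (by linarith) (by linarith)).trans
        (Real.rpow_le_rpow hρ.le hρR h)
  have e6 : a ^ 2 ≤ a ^ (2 - ε) * ρ ^ ε := by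
    calc a ^ 2 = a ^ (2 - ε) * a ^ ε := by rw [← Real.rpow_add ha]; simp
      _ ≤ _ := by gcongr
  have e7 : t ^ b ≤ ρ ^ b := by gcongr
  calc a ^ 2 / ρ ^ (2 * r) = y ^ (-p) * t ^ (-b) * (y ^ p * t ^ b * (a ^ 2 / ρ ^ (2 * r))) := by
        rw [Real.rpow_neg hy.le, Real.rpow_neg ht.le]
        field_simp
    _ ≤ y ^ (-p) * t ^ (-b) * (y ^ p * ρ ^ b * (a ^ (2 - ε) * ρ ^ ε / ρ ^ (2 * r))) := by gcongr
    _ = y ^ (-p) * t ^ (-b) * (y ^ p * (a ^ (2 - ε) * ρ ^ (ε - 2 * r + b))) := by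
        rw [Real.rpow_add hρ, Real.rpow_sub hρ]
        ring
    _ ≤ y ^ (-p) * t ^ (-b) * (y ^ p * (4 * x ^ (2 - ε) * R ^ (δ * ε - 2 * r + e))) := by gcongr
    _ = 4 * (y ^ (-p) * t ^ (-b) * (y ^ p * R ^ e * (x ^ (2 - ε) *
          R ^ (δ * (2 - (2 - ε)) - 2 * r)))) := by
        rw [Real.rpow_add hR, (by ring : δ * (2 - (2 - ε)) - 2 * r = δ * ε - 2 * r)]
        ring
    _ ≤ 4 * (y ^ (-p) * t ^ (-b) * (y ^ p * (2 ^ |e| * S ^ e) * lowWeight r δ x R)) := by gcongr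
    _ = 4 * 2 ^ |e| * (y ^ (-p) * t ^ (-b) * ((y ^ p * S ^ e) * lowWeight r δ x R)) := by ring
    _ ≤ _ := by
        gcongr
        exact lowWeight_nonneg hR.le

theorem sq_div_rpow_le_planar (hr0 : 0 ≤ r) (hr : r ≤ 1) (hδ : δ ≤ 2) (ha : 0 < a)
    (hax : a ≤ 2 * x) (hρ : ρ ^ 2 = a ^ 2 + t ^ 2) (hρ0 : 0 < ρ) (hR : 0 < R) (hRS : R ≤ 2 * S)
    (hS1 : S ≤ 1) (hy : 0 < y) :
    a ^ 2 / ρ ^ (2 * r) ≤ 4 * 2 ^ (2 * r) * (y ^ (-(2 - 2 * r)) * (x ^ 2 + t ^ 2) ^ (-r) *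
      (lowWeight r δ y S * lowWeight r δ x R)) := by
  have hx : 0 < x := by linarith
  have hS : 0 < S := by linarith
  have e1 := sq_div_le_lowWeight (r := r) (δ := δ) (x := x) hR.le
  have e2 := rpow_mul_rpow_le_lowWeight (r := r) (δ := δ) (p := 2 - 2 * r) hy hS (by linarith)
    (by linarith)
  have e3 : R ^ (2 * r) ≤ 2 ^ (2 * r) * S ^ (δ * (2 - (2 - 2 * r)) - 2 * r) := by
    calc R ^ (2 * r) ≤ (2 * S) ^ (2 * r) := by gcongr
      _ = 2 ^ (2 * r) * S ^ (2 * r) := Real.mul_rpow (by norm_num) hS.le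
      _ ≤ _ := by
        gcongr 2 ^ (2 * r) * ?_
        exact Real.rpow_le_rpow_of_exponent_ge hS hS1 (by nlinarith)
  have e4 : a ^ 2 / ρ ^ (2 * r) ≤ 4 * (x ^ 2 * (x ^ 2 + t ^ 2) ^ (-r)) := by
    have hP : 0 < a ^ 2 + t ^ 2 := by positivity
    have hX : 0 < x ^ 2 + t ^ 2 := by positivity
    have h1 : ρ ^ (2 * r) = (a ^ 2 + t ^ 2) ^ r := by
      rw [← hρ, ← Real.rpow_natCast, ← Real.rpow_mul hρ0.le]
      norm_num
    have h2 : (x ^ 2 + t ^ 2) ^ r ≤ (4 * (x ^ 2 / a ^ 2)) * (a ^ 2 + t ^ 2) ^ r := by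
      have h4 : 1 ≤ 4 * (x ^ 2 / a ^ 2) := by
        rw [← mul_div_assoc, one_le_div (by positivity)]
        nlinarith
      have h3 : x ^ 2 + t ^ 2 ≤ (4 * (x ^ 2 / a ^ 2)) * (a ^ 2 + t ^ 2) := by
        have : x ^ 2 / a ^ 2 * a ^ 2 = x ^ 2 := by field_simp
        nlinarith [sq_nonneg t, sq_nonneg x]
      calc (x ^ 2 + t ^ 2) ^ r ≤ ((4 * (x ^ 2 / a ^ 2)) * (a ^ 2 + t ^ 2)) ^ r := by gcongr
        _ = (4 * (x ^ 2 / a ^ 2)) ^ r * (a ^ 2 + t ^ 2) ^ r :=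
          Real.mul_rpow (by positivity) (by positivity)
        _ ≤ (4 * (x ^ 2 / a ^ 2)) ^ (1 : ℝ) * (a ^ 2 + t ^ 2) ^ r := by gcongr
        _ = _ := by rw [Real.rpow_one]
    rw [h1, Real.rpow_neg hX.le, div_le_iff₀ (by positivity)]
    calc a ^ 2 = a ^ 2 * (x ^ 2 + t ^ 2) ^ r * ((x ^ 2 + t ^ 2) ^ r)⁻¹ := by field_simp
      _ ≤ a ^ 2 * ((4 * (x ^ 2 / a ^ 2)) * (a ^ 2 + t ^ 2) ^ r) * ((x ^ 2 + t ^ 2) ^ r)⁻¹ := by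
          gcongr
      _ = _ := by field_simp
  have hL := lowWeight_nonneg (r := r) (δ := δ) (x := y) hS.le
  calc a ^ 2 / ρ ^ (2 * r) ≤ 4 * (x ^ 2 * (x ^ 2 + t ^ 2) ^ (-r)) := e4
    _ = 4 * (y ^ (-(2 - 2 * r)) * (x ^ 2 + t ^ 2) ^ (-r) *
          (y ^ (2 - 2 * r) * R ^ (2 * r) * (x ^ 2 / R ^ (2 * r)))) := by
        rw [Real.rpow_neg hy.le]
        field_simp
    _ ≤ 4 * (y ^ (-(2 - 2 * r)) * (x ^ 2 + t ^ 2) ^ (-r) *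
          (y ^ (2 - 2 * r) * (2 ^ (2 * r) * S ^ (δ * (2 - (2 - 2 * r)) - 2 * r)) *
            lowWeight r δ x R)) := by gcongr
    _ = 4 * 2 ^ (2 * r) * (y ^ (-(2 - 2 * r)) * (x ^ 2 + t ^ 2) ^ (-r) *
          (y ^ (2 - 2 * r) * S ^ (δ * (2 - (2 - 2 * r)) - 2 * r) * lowWeight r δ x R)) := by ring
    _ ≤ _ := by
        gcongr
        exact lowWeight_nonneg hR.le

end Weight

section Multiplier

variable {n : ℕ} {s r δ p b ε : ℝ}

theorem ballPow_of_lt {E : Type*} [Norm E] {M b : ℝ} {y : E} (hy : ‖y‖ < M) :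
    ballPow M b y = ENNReal.ofReal (‖y‖ ^ (-b)) := if_pos hy

theorem measurable_omegaW (d : ℕ) (hd : 0 < d) (s r δ : ℝ) : Measurable (omegaW d hd s r δ) :=
  Measurable.ite (measurableSet_lt measurable_norm measurable_const) (by fun_prop) (by fun_prop)

theorem omegaW_of_norm_lt_one (hd : 0 < n + 1) {ξ : EuclideanSpace ℝ (Fin (n + 1))}
    (hξ : ‖ξ‖ < 1) : omegaW (n + 1) hd s r δ ξ = ENNReal.ofReal (lowWeight r δ |ξ 0| ‖ξ‖) :=
  if_pos hξ

theorem omegaW_of_one_le_norm (hd : 0 < n + 1) {ξ : EuclideanSpace ℝ (Fin (n + 1))}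
    (hξ : 1 ≤ ‖ξ‖) : omegaW (n + 1) hd s r δ ξ = ENNReal.ofReal ((1 + ‖ξ‖ ^ 2) ^ s) :=
  if_neg hξ.not_gt

/-- Vectors whose first coordinate and tail are both nonzero. -/
def IsGeneric (x : EuclideanSpace ℝ (Fin (n + 1))) : Prop := x 0 ≠ 0 ∧ tailVec x ≠ 0

theorem measurableSet_isGeneric : MeasurableSet {x : EuclideanSpace ℝ (Fin (n + 1)) | IsGeneric x} :=
  (measurableSet_eq_fun (by fun_prop) measurable_const).compl.inter
    (measurableSet_eq_fun measurable_tailVec measurable_const).compl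

theorem IsGeneric.abs_head_pos {x : EuclideanSpace ℝ (Fin (n + 1))} (hx : IsGeneric x) :
    0 < |x 0| := abs_pos.2 hx.1

theorem IsGeneric.norm_tail_pos {x : EuclideanSpace ℝ (Fin (n + 1))} (hx : IsGeneric x) :
    0 < ‖tailVec x‖ := norm_pos_iff.2 hx.2

theorem IsGeneric.norm_pos {x : EuclideanSpace ℝ (Fin (n + 1))} (hx : IsGeneric x) : 0 < ‖x‖ :=
  hx.abs_head_pos.trans_le (abs_head_le x)

/-- An integrable majorant of the reciprocal of the weight. -/
noncomputable def recipMajorant (s p b : ℝ) (x : EuclideanSpace ℝ (Fin (n + 1))) : ℝ≥0∞ :=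
  ENNReal.ofReal ((1 + ‖x‖ ^ 2) ^ (-s)) + ballPow 1 p (x 0) * ballPow 1 b (tailVec x)

@[fun_prop]
theorem measurable_recipMajorant : Measurable (recipMajorant (n := n) s p b) := by
  unfold recipMajorant
  fun_prop

theorem lintegral_ballPow_mul_ballPow_ne_top (hn : 1 ≤ n) (hp : p < 1) (hb : b < n) :
    (∫⁻ t : ℝ, ballPow 1 p t) * ∫⁻ y : EuclideanSpace ℝ (Fin n), ballPow 1 b y ≠ ∞ :=
  ENNReal.mul_ne_top (lintegral_ballPow_ne_top volume (by simp) 1 (by simpa using hp))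
    (lintegral_ballPow_ne_top volume (by simpa using hn) 1 (by simpa using hb))

theorem lintegral_recipMajorant_ne_top (hn : 1 ≤ n) (hs : (n + 1 : ℝ) < 2 * s) (hp : p < 1)
    (hb : b < n) : ∫⁻ x : EuclideanSpace ℝ (Fin (n + 1)), recipMajorant s p b x ≠ ∞ := by
  unfold recipMajorant
  rw [lintegral_add_left (by fun_prop), lintegral_head_mul_tail (by fun_prop) (by fun_prop)]
  exact ENNReal.add_ne_top.2 ⟨lintegral_one_add_norm_sq_rpow_neg_ne_top volume (by simpa using hs),
    lintegral_ballPow_mul_ballPow_ne_top hn hp hb⟩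

theorem one_le_recipMajorant_mul_omegaW (hd : 0 < n + 1) {x : EuclideanSpace ℝ (Fin (n + 1))}
    (hx : IsGeneric x) (hp : 0 ≤ p) (hp2 : p ≤ 2) (hb : 0 ≤ b) (hpb : δ * (2 - p) - 2 * r ≤ b) :
    1 ≤ recipMajorant s p b x * omegaW (n + 1) hd s r δ x := by
  rcases lt_or_ge ‖x‖ 1 with h | h
  · have h1 := one_le_rpow_mul_lowWeight (r := r) (δ := δ) hx.abs_head_pos hx.norm_tail_pos
      (norm_tailVec_le x) h hp hp2 hb hpb
    calc (1 : ℝ≥0∞) ≤ ENNReal.ofReal (|x 0| ^ (-p) * ‖tailVec x‖ ^ (-b) *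
          lowWeight r δ |x 0| ‖x‖) := by simpa using ENNReal.ofReal_le_ofReal h1
      _ = ballPow 1 p (x 0) * ballPow 1 b (tailVec x) * omegaW (n + 1) hd s r δ x := by
        rw [ENNReal.ofReal_mul (by positivity), ENNReal.ofReal_mul (by positivity),
          omegaW_of_norm_lt_one hd h, ballPow_of_lt ((norm_tailVec_le x).trans_lt h),
          ballPow_of_lt (y := x 0) ((abs_head_le x).trans_lt h), Real.norm_eq_abs]
      _ ≤ _ := by
        gcongr
        exact le_add_self
  · calc (1 : ℝ≥0∞) = ENNReal.ofReal ((1 + ‖x‖ ^ 2) ^ (-s)) * omegaW (n + 1) hd s r δ x := by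
          rw [omegaW_of_one_le_norm hd h, ← ENNReal.ofReal_mul (by positivity),
            ← Real.rpow_add (by positivity)]
          simp
      _ ≤ _ := by
        gcongr
        exact le_self_add

theorem omegaW_le_of_half_le_norm (hd : 0 < n + 1) (hδ : 1 ≤ δ) (hr : r ≤ 1) (hs : 0 ≤ s)
    {ξ η : EuclideanSpace ℝ (Fin (n + 1))} (hξ : ξ ≠ 0) (hξη : ‖ξ‖ ≤ 2 * ‖η‖)
    (hη : 1 / 2 ≤ ‖η‖) :
    omegaW (n + 1) hd s r δ ξ ≤ ENNReal.ofReal (2 * 4 ^ s * (2 ^ s * 2 ^ (2 * δ - 2 * r))) *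
      omegaW (n + 1) hd s r δ η := by
  have h2 : (1 : ℝ) ≤ 2 ^ (2 * δ - 2 * r) := Real.one_le_rpow (by norm_num) (by linarith)
  have h2s : (1 : ℝ) ≤ 2 ^ s := Real.one_le_rpow (by norm_num) hs
  have h1 : omegaW (n + 1) hd s r δ ξ ≤ ENNReal.ofReal (2 * (1 + ‖ξ‖ ^ 2) ^ s) := by
    have h3 : (1 : ℝ) ≤ (1 + ‖ξ‖ ^ 2) ^ s := Real.one_le_rpow (by nlinarith [sq_nonneg ‖ξ‖]) hs
    rcases lt_or_ge ‖ξ‖ 1 with h | h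
    · rw [omegaW_of_norm_lt_one hd h]
      refine ENNReal.ofReal_le_ofReal (le_trans ?_ (by linarith : (2 : ℝ) ≤ _))
      have hpos : 0 < ‖ξ‖ := norm_pos_iff.2 hξ
      rw [lowWeight, div_le_iff₀ (by positivity)]
      have e1 : ‖ξ‖ ^ (2 : ℝ) ≤ ‖ξ‖ ^ (2 * r) :=
        Real.rpow_le_rpow_of_exponent_ge hpos h.le (by linarith)
      have e2 : ‖ξ‖ ^ (2 * δ) ≤ ‖ξ‖ ^ (2 * r) :=
        Real.rpow_le_rpow_of_exponent_ge hpos h.le (by linarith)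
      rw [Real.rpow_two] at e1
      have e3 := abs_head_le ξ
      have e4 : |ξ 0| ^ 2 ≤ ‖ξ‖ ^ 2 := by gcongr
      linarith
    · rw [omegaW_of_one_le_norm hd h]
      exact ENNReal.ofReal_le_ofReal (by linarith)
  have h4 : ENNReal.ofReal ((1 + ‖η‖ ^ 2) ^ s) ≤
      ENNReal.ofReal (2 ^ s * 2 ^ (2 * δ - 2 * r)) * omegaW (n + 1) hd s r δ η := by
    rcases lt_or_ge ‖η‖ 1 with h | h
    · rw [omegaW_of_norm_lt_one hd h, ← ENNReal.ofReal_mul (by positivity), mul_assoc]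
      refine ENNReal.ofReal_le_ofReal ?_
      have e0 : 0 < ‖η‖ := by linarith
      have e1 := rpow_le_lowWeight (r := r) (δ := δ) (x := |η 0|) e0
      have e2 : (1 + ‖η‖ ^ 2) ^ s ≤ 2 ^ s := by
        gcongr
        nlinarith
      have e3 : 1 ≤ (2 : ℝ) ^ (2 * δ - 2 * r) * ‖η‖ ^ (2 * δ - 2 * r) := by
        rw [← Real.mul_rpow (by norm_num) e0.le]
        exact Real.one_le_rpow (by linarith) (by linarith)
      calc (1 + ‖η‖ ^ 2) ^ s ≤ 2 ^ s * 1 := by simpa using e2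
        _ ≤ 2 ^ s * (2 ^ (2 * δ - 2 * r) * ‖η‖ ^ (2 * δ - 2 * r)) := by gcongr
        _ ≤ _ := by gcongr
    · rw [omegaW_of_one_le_norm hd h]
      refine le_mul_of_one_le_left zero_le ?_
      rw [← ENNReal.ofReal_one]
      exact ENNReal.ofReal_le_ofReal (one_le_mul_of_one_le_of_one_le h2s h2)
  refine h1.trans ?_
  rw [ENNReal.ofReal_mul (p := 2 * 4 ^ s) (by positivity), mul_assoc (ENNReal.ofReal _)]
  refine le_trans ?_ (mul_le_mul_right h4 _)
  rw [← ENNReal.ofReal_mul (by positivity)]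
  refine ENNReal.ofReal_le_ofReal ?_
  rw [mul_assoc, ← Real.mul_rpow (by norm_num) (by positivity)]
  gcongr
  nlinarith [norm_nonneg ξ]

/-- Pairs of low frequencies whose sum is much smaller than both of them. -/
def cancelSet (n : ℕ) (r : ℝ) :
    Set (EuclideanSpace ℝ (Fin (n + 1)) × EuclideanSpace ℝ (Fin (n + 1))) :=
  {z | 0 < r ∧ ‖z.1‖ < 1 / 2 ∧ ‖z.2‖ < 1 / 2 ∧ 4 * ‖z.1 + z.2‖ < ‖z.1‖ ∧ 4 * ‖z.1 + z.2‖ < ‖z.2‖}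

theorem measurableSet_cancelSet : MeasurableSet (cancelSet n r) := by
  simp only [cancelSet, Set.ofPred_and]
  refine (MeasurableSet.const _).inter (((measurableSet_lt ?_ ?_)).inter ((measurableSet_lt ?_ ?_).inter
    ((measurableSet_lt ?_ ?_).inter (measurableSet_lt ?_ ?_)))) <;> fun_prop

theorem le_mul_mul_of_one_le {a x y z w : ℝ≥0∞} (h : x ≤ a * y) (hzw : 1 ≤ z * w) :
    x ≤ a * (z * (w * y)) :=
  calc x ≤ a * (1 * y) := by simpa using h
    _ ≤ a * (z * w * y) := by gcongr
    _ = _ := by ring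

theorem omegaW_add_le_of_notMem_cancelSet (hd : 0 < n + 1) (hδ : 1 ≤ δ) (hr : r ≤ 1) (hs : 0 ≤ s)
    (hp : 0 ≤ p) (hp2 : p ≤ 2) (hb : 0 ≤ b) (hpb : δ * (2 - p) - 2 * r ≤ b) :
    ∃ C : ℝ, ∀ ζ η : EuclideanSpace ℝ (Fin (n + 1)), IsGeneric ζ → IsGeneric η →
      IsGeneric (ζ + η) → ‖ζ‖ ≤ ‖η‖ → (ζ, η) ∉ cancelSet n r →
      omegaW (n + 1) hd s r δ (ζ + η) ≤ ENNReal.ofReal C *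
        (recipMajorant s p b ζ + recipMajorant s p b η +
          ballPow 1 p (η 0) * ballPow 1 b (tailVec ζ)) *
        (omegaW (n + 1) hd s r δ ζ * omegaW (n + 1) hd s r δ η) := by
  set C₀ : ℝ := 2 * 4 ^ s * (2 ^ s * 2 ^ (2 * δ - 2 * r))
  set C₁ : ℝ := 2 ^ (2 * δ - 2 * r)
  set C₂ : ℝ := 2 ^ (2 * δ) * 5 ^ (2 * r)
  have p0 : 0 ≤ C₀ := by positivity
  have p1 : 0 ≤ C₁ := by positivity
  have p2 : 0 ≤ C₂ := by positivity
  refine ⟨C₀ + C₁ + C₂, fun ζ η hζ hη hξ hle hbad => ?_⟩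
  set ξ := ζ + η with hξdef
  set W := omegaW (n + 1) hd s r δ
  have hQζ := one_le_recipMajorant_mul_omegaW (s := s) (δ := δ) (r := r) hd hζ hp hp2 hb hpb
  have hQη := one_le_recipMajorant_mul_omegaW (s := s) (δ := δ) (r := r) hd hη hp hp2 hb hpb
  have hnorm : ‖ξ‖ ≤ ‖ζ‖ + ‖η‖ := norm_add_le _ _
  have habs : |ξ 0| ≤ |η 0| + |ζ 0| := by
    rw [add_comm |η 0|]
    exact abs_add_le _ _
  rw [mul_assoc]
  rcases le_or_gt (1 / 2) ‖η‖ with h | h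
  · have := omegaW_le_of_half_le_norm (s := s) hd hδ hr hs (norm_pos_iff.1 hξ.norm_pos)
      (by linarith) h
    refine (le_mul_mul_of_one_le this hQζ).trans ?_
    gcongr
    · linarith
    · rw [add_assoc]
      exact le_self_add
  have hζ1 : ‖ζ‖ < 1 := by linarith
  rw [show W ξ = ENNReal.ofReal (lowWeight r δ |ξ 0| ‖ξ‖) from omegaW_of_norm_lt_one hd (by linarith)]
  have eζ : W ζ = ENNReal.ofReal (lowWeight r δ |ζ 0| ‖ζ‖) := omegaW_of_norm_lt_one hd hζ1
  have eη : W η = ENNReal.ofReal (lowWeight r δ |η 0| ‖η‖) := omegaW_of_norm_lt_one hd (by linarith)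
  have nζ := lowWeight_nonneg (r := r) (δ := δ) (x := |ζ 0|) (norm_nonneg ζ)
  have nη := lowWeight_nonneg (r := r) (δ := δ) (x := |η 0|) (norm_nonneg η)
  rcases le_or_gt r 0 with hr0 | hr0
  · have h3 := lowWeight_le_of_nonpos (δ := δ) hr0 hδ (abs_nonneg (ξ 0)) hξ.norm_pos habs
      (by linarith) hle hζ1 hη.abs_head_pos hζ.norm_tail_pos (norm_tailVec_le ζ) hp hp2 hb hpb
    refine (ENNReal.ofReal_le_ofReal h3).trans ?_
    rw [ENNReal.ofReal_mul p1, ENNReal.ofReal_add nη (by positivity), ENNReal.ofReal_mul (by positivity),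
      ENNReal.ofReal_mul (by positivity), ENNReal.ofReal_mul nζ, ← eζ, ← eη,
      ← Real.norm_eq_abs, ← ballPow_of_lt (M := 1), ← ballPow_of_lt (M := 1)]
    · have h5 : W η ≤ recipMajorant s p b ζ * (W ζ * W η) := by
        simpa using le_mul_mul_of_one_le (a := 1) (by simp) hQζ
      gcongr
      · linarith
      · rw [add_mul, add_mul]
        gcongr
        exact h5.trans le_self_add
    · exact (norm_tailVec_le ζ).trans_lt hζ1
    · exact (abs_head_le η).trans_lt (by linarith)
  · have hR : ‖η‖ ≤ 5 * ‖ξ‖ := by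
      by_contra! hcon
      have h6 : ‖η‖ ≤ ‖ξ‖ + ‖ζ‖ := by
        have := norm_sub_le ξ ζ
        rwa [hξdef, add_sub_cancel_left] at this
      exact hbad ⟨hr0, by linarith, h, by simp only [← hξdef]; linarith,
        by simp only [← hξdef]; linarith [norm_nonneg ξ]⟩
    have h3 := lowWeight_le_add_of_nonneg (δ := δ) hr0.le hδ (abs_nonneg (ξ 0)) hξ.norm_pos habs
      (by linarith) hR hζ.norm_pos hle
    refine (ENNReal.ofReal_le_ofReal h3).trans ?_
    rw [ENNReal.ofReal_mul p2, ENNReal.ofReal_add nη nζ, ← eζ, ← eη]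
    have h5 : W η ≤ recipMajorant s p b ζ * (W ζ * W η) := by
      simpa using le_mul_mul_of_one_le (a := 1) (by simp) hQζ
    have h6 : W ζ ≤ recipMajorant s p b η * (W ζ * W η) := by
      rw [mul_comm (W ζ)]
      simpa using le_mul_mul_of_one_le (a := 1) (by simp) hQη
    gcongr
    · linarith
    · rw [add_mul, add_mul]
      exact (add_le_add h5 h6).trans le_self_add

end Multiplier

section Cancellation

variable {n : ℕ} {s r δ p b ε : ℝ}

theorem omegaW_add_le_of_mem_cancelSet (hd : 0 < n + 1) (hδr : r ≤ δ)
    {ζ η : EuclideanSpace ℝ (Fin (n + 1))} (hξ : IsGeneric (ζ + η)) (h : (ζ, η) ∈ cancelSet n r) :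
    omegaW (n + 1) hd s r δ (ζ + η) ≤ omegaW (n + 1) hd s r δ η +
      ENNReal.ofReal (|(ζ + η) 0| ^ 2 / ‖ζ + η‖ ^ (2 * r)) := by
  obtain ⟨-, -, hη, -, hξη⟩ := h
  have h0 := hξ.norm_pos
  simp only at hη hξη
  rw [omegaW_of_norm_lt_one hd (by linarith), omegaW_of_norm_lt_one hd (by linarith),
    ← ENNReal.ofReal_add (lowWeight_nonneg (norm_nonneg _)) (by positivity)]
  exact ENNReal.ofReal_le_ofReal (lowWeight_le_add_sq_div hδr h0 (by linarith))

/-- A kernel with uniformly bounded column integrals controls the singular part of the weight of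
the sum of two cancelling frequencies. -/
def HasCancelKernel (n : ℕ) (hd : 0 < n + 1) (s r δ : ℝ) : Prop :=
  ∃ (H : EuclideanSpace ℝ (Fin (n + 1)) → EuclideanSpace ℝ (Fin (n + 1)) → ℝ≥0∞) (K : ℝ≥0∞),
    K ≠ ∞ ∧ Measurable (Function.uncurry H) ∧ (∀ η, ∫⁻ ξ, H ξ η ≤ K) ∧
    ∀ ζ η, IsGeneric ζ → IsGeneric η → IsGeneric (ζ + η) → (ζ, η) ∈ cancelSet n r → |ζ 0| ≤ |η 0| →
      ENNReal.ofReal (|(ζ + η) 0| ^ 2 / ‖ζ + η‖ ^ (2 * r)) ≤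
        H (ζ + η) η * (omegaW (n + 1) hd s r δ ζ * omegaW (n + 1) hd s r δ η)

theorem norm_le_two_mul_of_mem_cancelSet {ζ η : EuclideanSpace ℝ (Fin (n + 1))}
    (h : (ζ, η) ∈ cancelSet n r) : ‖η‖ ≤ 2 * ‖ζ‖ ∧ ‖ζ‖ ≤ 2 * ‖η‖ := by
  obtain ⟨-, -, -, h1, h2⟩ := h
  simp only at h1 h2
  have h3 := norm_sub_le (ζ + η) ζ
  have h4 := norm_sub_le (ζ + η) η
  rw [add_sub_cancel_left] at h3
  rw [add_sub_cancel_right] at h4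
  constructor <;> linarith [norm_nonneg ζ, norm_nonneg η]

theorem abs_add_head_le {ζ η : EuclideanSpace ℝ (Fin (n + 1))} (h : |ζ 0| ≤ |η 0|) :
    |(ζ + η) 0| ≤ 2 * |η 0| := by
  have : |(ζ + η) 0| ≤ |ζ 0| + |η 0| := abs_add_le _ _
  linarith

theorem hasCancelKernel_of_exponents (hd : 0 < n + 1) (hn : 1 ≤ n) (hp : 0 ≤ p) (hp1 : p < 1)
    (hε : 0 ≤ ε) (hε2 : ε ≤ 2) (hb : 0 ≤ b) (hbn : b < n) (hb1 : 2 * r - ε ≤ b)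
    (hb2 : δ * (2 - p) - 2 * r + (δ - 1) * ε ≤ b) : HasCancelKernel n hd s r δ := by
  set C : ℝ := 4 * 2 ^ |δ * (2 - p) - 2 * r|
  refine ⟨fun ξ η => ENNReal.ofReal C * (ballPow 1 p (ξ 0 - η 0) * ballPow 1 b (tailVec ξ)),
    ENNReal.ofReal C * ((∫⁻ t : ℝ, ballPow 1 p t) * ∫⁻ y : EuclideanSpace ℝ (Fin n), ballPow 1 b y),
    ENNReal.mul_ne_top ENNReal.ofReal_ne_top (lintegral_ballPow_mul_ballPow_ne_top hn hp1 hbn),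
    by unfold Function.uncurry; fun_prop, fun η => ?_, fun ζ η hζ hη hξ hbad hhead => ?_⟩
  · rw [lintegral_const_mul _ (by fun_prop), lintegral_head_sub_mul_tail (by fun_prop) (by fun_prop)]
  · obtain ⟨hηζ, hζη⟩ := norm_le_two_mul_of_mem_cancelSet hbad
    obtain ⟨-, hζ1, hη1, -, hξη⟩ := hbad
    simp only at hζ1 hη1 hξη
    have hξ0 := hξ.norm_pos
    have h := sq_div_rpow_le_rpow_mul_lowWeight (δ := δ) hξ.abs_head_pos (abs_head_le _)
      (abs_add_head_le hhead) hξ.norm_tail_pos (norm_tailVec_le _) (by linarith : _ ≤ ‖η‖)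
      (by linarith) hηζ hζη hζ.abs_head_pos hp (by linarith) hε hε2 hb hb1 hb2
    have hC : 0 ≤ C := by positivity
    change _ ≤ C * _ at h
    clear_value C
    refine (ENNReal.ofReal_le_ofReal h).trans (le_of_eq ?_)
    have e : (ζ + η) 0 - η 0 = ζ 0 := add_sub_cancel_right _ _
    simp only [e]
    rw [ENNReal.ofReal_mul hC, ENNReal.ofReal_mul (by positivity),
      ENNReal.ofReal_mul (by positivity), ENNReal.ofReal_mul (lowWeight_nonneg (norm_nonneg _)),
      omegaW_of_norm_lt_one hd (by linarith), omegaW_of_norm_lt_one hd (by linarith),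
      ballPow_of_lt (y := tailVec (ζ + η)) (by linarith [norm_tailVec_le (ζ + η)]),
      ballPow_of_lt (y := ζ 0) ((abs_head_le ζ).trans_lt (by linarith)), Real.norm_eq_abs, mul_assoc (ENNReal.ofReal C)]

theorem hasCancelKernel_planar (hd : 0 < 1 + 1) (hr : 1 / 2 < r) (hr1 : r ≤ 1) (hδ : δ ≤ 2) :
    HasCancelKernel 1 hd s r δ := by
  set C : ℝ := 4 * 2 ^ (2 * r)
  refine ⟨fun ξ η => ENNReal.ofReal C * planarKernel r ξ η,
    ENNReal.ofReal C * ((∫⁻ t : ℝ, ballPow 4 (2 - 2 * r) t) *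
      ∫⁻ y : EuclideanSpace ℝ (Fin 1), ENNReal.ofReal ((1 + ‖y‖ ^ 2) ^ (-r))),
    ENNReal.mul_ne_top ENNReal.ofReal_ne_top (ENNReal.mul_ne_top
      (lintegral_ballPow_ne_top volume (by simp) 4 (by simp; linarith))
      (lintegral_one_add_norm_sq_rpow_neg_ne_top volume (by simp; linarith))),
    (measurable_planarKernel r).const_mul _, fun η => ?_, fun ζ η hζ hη hξ hbad hhead => ?_⟩
  · rw [lintegral_const_mul _ ((measurable_planarKernel r).of_uncurry_right)]
    gcongr
    exact lintegral_planarKernel_le η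
  · obtain ⟨hηζ, hζη⟩ := norm_le_two_mul_of_mem_cancelSet hbad
    obtain ⟨-, hζ1, hη1, -, hξη⟩ := hbad
    simp only at hζ1 hη1 hξη
    have h := sq_div_rpow_le_planar (δ := δ) (by linarith) hr1 hδ hξ.abs_head_pos
      (abs_add_head_le hhead) (norm_sq_eq_add_tailVec (ζ + η)) hξ.norm_pos hη.norm_pos hηζ
      (by linarith) hζ.abs_head_pos
    have hC : 0 ≤ C := by positivity
    change _ ≤ C * _ at h
    clear_value C
    refine (ENNReal.ofReal_le_ofReal h).trans (le_of_eq ?_)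
    have e : (ζ + η) 0 - η 0 = ζ 0 := add_sub_cancel_right _ _
    simp only [planarKernel, e]
    rw [ENNReal.ofReal_mul hC, ENNReal.ofReal_mul (by positivity),
      ENNReal.ofReal_mul (by positivity), ENNReal.ofReal_mul (lowWeight_nonneg (norm_nonneg _)),
      omegaW_of_norm_lt_one hd (by linarith), omegaW_of_norm_lt_one hd (by linarith),
      ballPow_of_lt (y := ζ 0) (by rw [Real.norm_eq_abs]; linarith [hη.abs_head_pos]),
      Real.norm_eq_abs, mul_assoc (ENNReal.ofReal C)]

end Cancellation

section Algebra

variable {n : ℕ} {s r δ : ℝ}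

theorem exists_exponents (hn : 1 ≤ n) (hδ : 1 < δ) (hdim : δ - 2 * r < n) :
    ∃ ε b : ℝ, 0 < ε ∧ ε < 1 ∧ 0 ≤ b ∧ b < n ∧ δ * (1 + ε) - 2 * r + (δ - 1) * ε ≤ b ∧
      (2 * r ≤ n → 2 * r - ε ≤ b) := by
  have hn' : (1 : ℝ) ≤ n := by exact_mod_cast hn
  set μ : ℝ := n + 2 * r - δ with hμ
  have hμ0 : 0 < μ := by linarith
  have h2 : 0 < 2 * (2 * δ - 1) := by linarith
  set ε : ℝ := min (1 / 2) (μ / (2 * (2 * δ - 1))) with hε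
  have hε0 : 0 < ε := lt_min (by norm_num) (by positivity)
  have hε1 : ε ≤ 1 / 2 := min_le_left _ _
  have hε2 : ε * (2 * (2 * δ - 1)) ≤ μ := by
    rw [← le_div_iff₀ h2]
    exact min_le_right _ _
  refine ⟨ε, max 0 (max (δ * (1 + ε) - 2 * r + (δ - 1) * ε) (min (2 * r) n - ε)), hε0, by linarith,
    le_max_left _ _, max_lt (by linarith) (max_lt (by nlinarith) ?_),
    (le_max_left _ _).trans (le_max_right _ _), fun h => ?_⟩
  · linarith [min_le_right (2 * r) n]
  · rw [min_eq_left h]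
    exact (le_max_right _ _).trans (le_max_right _ _)

theorem hasCancelKernel (hd : 0 < n + 1) (hn : 1 ≤ n) (hδ : 1 < δ) (hdim : δ - 2 * r < n)
    (hr : r ≤ 1) (hcase : 2 ≤ n ∨ (n = 1 ∧ δ ≤ 2)) : HasCancelKernel n hd s r δ := by
  by_cases h : 2 * r ≤ n
  · obtain ⟨ε, b, hε, hε1, hb, hbn, hb1, hb2⟩ := exists_exponents hn hδ hdim
    exact hasCancelKernel_of_exponents (p := 1 - ε) hd hn (by linarith) (by linarith) hε.le
      (by linarith) hb hbn (hb2 h) (by rwa [show 2 - (1 - ε) = 1 + ε by ring])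
  · rcases hcase with h2 | ⟨rfl, hδ2⟩
    · have : (2 : ℝ) ≤ n := by exact_mod_cast h2
      exact absurd (by linarith) h
    · push_cast at h
      exact hasCancelKernel_planar hd (by linarith) hr hδ2

theorem IsGeneric.sub_of_ae (hn : 1 ≤ n) :
    ∀ᵐ ξ : EuclideanSpace ℝ (Fin (n + 1)), IsGeneric ξ ∧ ∀ᵐ η, IsGeneric η ∧ IsGeneric (ξ - η) := by
  have h := ae_head_ne_zero_and_tail_ne_zero hn
  filter_upwards [h] with ξ hξ
  refine ⟨hξ, h.and ?_⟩
  exact (Measure.measurePreserving_sub_left volume ξ).quasiMeasurePreserving.ae h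

theorem exists_lintegral_omegaW_mul_sq_conv_le (hd : 0 < n + 1) (hn : 1 ≤ n) (hδ : 1 < δ)
    (hdim : δ - 2 * r < n) (hr : r ≤ 1) (hs : (n + 1 : ℝ) < 2 * s)
    (hcase : 2 ≤ n ∨ (n = 1 ∧ δ ≤ 2)) :
    ∃ K : ℝ≥0∞, K ≠ ∞ ∧ ∀ f g : EuclideanSpace ℝ (Fin (n + 1)) → ℝ≥0∞, Measurable f → Measurable g →
      ∫⁻ ξ, omegaW (n + 1) hd s r δ ξ * (∫⁻ η, f (ξ - η) * g η) ^ 2 ≤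
        K * ((∫⁻ ξ, omegaW (n + 1) hd s r δ ξ * f ξ ^ 2) *
          ∫⁻ ξ, omegaW (n + 1) hd s r δ ξ * g ξ ^ 2) := by
  obtain ⟨ε, b, hε, hε1, hb, hbn, hb1, -⟩ := exists_exponents hn hδ hdim
  obtain ⟨H, K, hK, hH, hHK, hcancel⟩ := hasCancelKernel (s := s) hd hn hδ hdim hr hcase
  set p := 1 - ε with hp
  have hp0 : 0 ≤ p := by linarith
  have hp2 : p ≤ 2 := by linarith
  have hpb : δ * (2 - p) - 2 * r ≤ b := by
    rw [show 2 - p = 1 + ε by rw [hp]; ring]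
    nlinarith
  obtain ⟨C, hC⟩ := omegaW_add_le_of_notMem_cancelSet (n := n) (s := s) hd hδ.le hr (by linarith)
    hp0 hp2 hb hpb
  set W := omegaW (n + 1) hd s r δ
  set Q := ∫⁻ x : EuclideanSpace ℝ (Fin (n + 1)), recipMajorant s p b x
  set P := (∫⁻ t : ℝ, ballPow 1 p t) * ∫⁻ y : EuclideanSpace ℝ (Fin n), ballPow 1 b y
  have hQ : Q ≠ ∞ := lintegral_recipMajorant_ne_top hn hs (by linarith) hbn
  have hP : P ≠ ∞ := lintegral_ballPow_mul_ballPow_ne_top hn (by linarith) hbn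
  have hgen : MeasurableSet {x : EuclideanSpace ℝ (Fin (n + 1)) | IsGeneric x} :=
    measurableSet_isGeneric
  have hgen3 : MeasurableSet {z : EuclideanSpace ℝ (Fin (n + 1)) × EuclideanSpace ℝ (Fin (n + 1)) |
      IsGeneric z.1 ∧ IsGeneric z.2 ∧ IsGeneric (z.1 + z.2)} :=
    (measurable_fst hgen).inter ((measurable_snd hgen).inter
      ((measurable_fst.add measurable_snd) hgen))
  refine ⟨8 * (ENNReal.ofReal C * (Q + Q + P) + (Q + K)), by finiteness, fun f g hf hg =>
    lintegral_sq_conv_le (measurable_omegaW _ _ _ _ _) hf hg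
      (H₁ := fun ξ η => ENNReal.ofReal C * (recipMajorant s p b (ξ - η) + recipMajorant s p b η +
          ballPow 1 p (η 0) * ballPow 1 b (tailVec (ξ - η))))
      (H₂ := fun ξ η => recipMajorant s p b (ξ - η) + H ξ η)
      (by unfold Function.uncurry; fun_prop)
      (by
        refine Measurable.add ?_ hH
        fun_prop)
      (A₁ := {z | IsGeneric z.1 ∧ IsGeneric z.2 ∧ IsGeneric (z.1 + z.2)} ∩
        ({z | ‖z.1‖ ≤ ‖z.2‖} ∩ (cancelSet n r)ᶜ))
      (A₂ := {z | IsGeneric z.1 ∧ IsGeneric z.2 ∧ IsGeneric (z.1 + z.2)} ∩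
        ({z | |z.1 0| ≤ |z.2 0|} ∩ cancelSet n r))
      (hgen3.inter ((measurableSet_le (by fun_prop) (by fun_prop)).inter
        measurableSet_cancelSet.compl))
      (hgen3.inter ((measurableSet_le (by fun_prop) (by fun_prop)).inter measurableSet_cancelSet))
      (B := Metric.ball 0 1) measurableSet_ball measure_ball_lt_top.ne ?_ ?_ ?_ ?_ ?_ ?_⟩
  · rintro ξ η ⟨-, -, -, -, hη, -, hξ⟩
    simp only [sub_add_cancel] at hη hξ
    rw [mem_ball_zero_iff]
    linarith [norm_nonneg η]
  · rintro ξ η ⟨⟨hζ, hη, hξ⟩, hle, hbad⟩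
    have := hC _ _ hζ hη hξ hle hbad
    simpa only [sub_add_cancel] using this
  · rintro ξ η ⟨⟨hζ, hη, hξ⟩, hle, hbad⟩
    have h1 := omegaW_add_le_of_mem_cancelSet (s := s) hd (hr.trans hδ.le) hξ hbad
    have h2 := hcancel _ _ hζ hη hξ hbad hle
    have h3 := one_le_recipMajorant_mul_omegaW (s := s) (δ := δ) (r := r) hd hζ hp0 hp2 hb hpb
    simp only [sub_add_cancel] at h1 h2
    rw [add_mul]
    refine h1.trans (add_le_add ?_ h2)
    exact (le_mul_mul_of_one_le (one_mul (W η)).ge h3).trans_eq (one_mul _)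
  · intro ξ
    rw [lintegral_const_mul _ (by fun_prop), lintegral_add_left (by fun_prop),
      lintegral_add_left (by fun_prop), lintegral_sub_left_eq_self (recipMajorant s p b),
      lintegral_head_mul_sub_tail (by fun_prop) (by fun_prop)]
  · intro η
    rw [lintegral_add_left (by fun_prop), lintegral_sub_right_eq_self (recipMajorant s p b)]
    gcongr
    exact hHK η
  · filter_upwards [IsGeneric.sub_of_ae hn] with ξ ⟨hξ, hη⟩
    filter_upwards [hη] with η ⟨hη, hζ⟩
    have hsym : (ξ - η, η) ∈ cancelSet n r ↔ (η, ξ - η) ∈ cancelSet n r := by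
      simp only [cancelSet, Set.mem_ofPred_eq, sub_add_cancel, add_sub_cancel]
      tauto
    by_cases hbad : (ξ - η, η) ∈ cancelSet n r
    · rcases le_total |(ξ - η) 0| |η 0| with h | h
      · exact .inl (.inr ⟨⟨hζ, hη, by simpa using hξ⟩, h, hbad⟩)
      · exact .inr (.inr ⟨⟨hη, hζ, by simpa using hξ⟩, h, hsym.1 hbad⟩)
    · rcases le_total ‖ξ - η‖ ‖η‖ with h | h
      · exact .inl (.inl ⟨⟨hζ, hη, by simpa using hξ⟩, h, hbad⟩)
      · exact .inr (.inl ⟨⟨hη, hζ, by simpa using hξ⟩, h, fun h' => hbad (hsym.2 h')⟩)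

theorem ENNReal.exists_le_ofReal_sq {K : ℝ≥0∞} (hK : K ≠ ∞) :
    ∃ C : ℝ, 0 < C ∧ K ≤ ENNReal.ofReal C ^ 2 := by
  refine ⟨K.toReal + 1, by positivity, ?_⟩
  rw [← ENNReal.ofReal_pow (by positivity)]
  refine ENNReal.le_ofReal_iff_toReal_le hK (by positivity) |>.2 ?_
  nlinarith [ENNReal.toReal_nonneg (a := K)]

end Algebra

theorem stmt17 (d : ℕ) (hd : 2 ≤ d) (s r δ : ℝ) (hδ : 1 < δ)
    (hdim : 1 + δ - 2 * r < (d : ℝ)) (hr : r ≤ 1) (hs : (d : ℝ) / 2 < s)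
    (hcase : 3 ≤ d ∨ (d = 2 ∧ δ ≤ 2)) :
    ∃ C : ℝ, 0 < C ∧ ∀ F G : EuclideanSpace ℝ (Fin d) → ℝ,
      Measurable F → (∀ ξ, 0 ≤ F ξ) → Measurable G → (∀ ξ, 0 ≤ G ξ) →
      (∫⁻ ξ, omegaW d (by omega) s r δ ξ * (convNN d F G ξ) ^ 2) ≤
      ENNReal.ofReal C ^ 2 *
        ((∫⁻ ξ, omegaW d (by omega) s r δ ξ * ENNReal.ofReal (F ξ) ^ 2) *
         (∫⁻ ξ, omegaW d (by omega) s r δ ξ * ENNReal.ofReal (G ξ) ^ 2)) := by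
  obtain ⟨n, rfl⟩ : ∃ n, d = n + 1 := ⟨d - 1, by omega⟩
  push_cast at hdim hs
  obtain ⟨K, hK, h⟩ := exists_lintegral_omegaW_mul_sq_conv_le (n := n) (s := s) (r := r) (δ := δ)
    (by omega) (by omega) hδ (by linarith) hr (by linarith) (hcase.imp (by omega) fun h => ⟨by omega, h.2⟩)
  obtain ⟨C, hC, hKC⟩ := ENNReal.exists_le_ofReal_sq hK
  refine ⟨C, hC, fun F G hF _ hG _ => ?_⟩
  refine (h _ _ hF.ennreal_ofReal hG.ennreal_ofReal).trans ?_
  gcongr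
end

section
/- Let d ≥ 2 be an integer and let s, r, δ, σ ∈ ℝ satisfy δ > 1, d > 1 + δ − 2r, r ≥ 0, σ ≤ s, and 1 − r ≤ s. Let φ : ℝ^d → [0,∞) be continuous and suppose there are constants 0 < c ≤ c' such that c|ξ|^δ ≤ φ(ξ) ≤ c'|ξ|^δ for 0 < |ξ| ≤ 1 and c|ξ|^σ ≤ φ(ξ) ≤ c'|ξ|^σ for |ξ| ≥ 1. Let γ, β ∈ ℝ \ {0} and set m(ξ) = −2πiγξ₁ + βφ(ξ). Then m(ξ) ≠ 0 for all ξ ≠ 0, and there exists a constant C > 0 such that for every measurable g : ℝ^d → ℂ with M := ∫_{B(0,1)} |ξ|^{−2r}|g(ξ)|² dξ + ∫_{B(0,1)^c} (1+|ξ|²)^s |g(ξ)|² dξ < ∞, the function u(ξ) = g(ξ)/m(ξ) is (up to almost-everywhere equality) the unique measurable function with m(ξ)u(ξ) = g(ξ) for a.e. ξ, and it satisfies ∫_{ℝ^d} ω_{s+σ,r,δ}(ξ) |u(ξ)|² dξ ≤ C·M. (This is the Fourier-side form of the unique solvability, with estimate in X^{s+σ}_{r,δ}, of the traveling wave equation −γ∂₁u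 + βφ(D)u = f for f ∈ H^s ∩ Ḣ^{−r}.) -/
open MeasureTheory

/-- The Japanese bracket is comparable to the norm away from the unit ball. -/
lemma one_add_sq_rpow_le {x : ℝ} (hx : 1 ≤ x) (σ : ℝ) :
    (1 + x ^ 2) ^ σ ≤ 2 ^ |σ| * (x ^ σ) ^ 2 := by
  have hx0 : 0 < x := by linarith
  have hx2 : 0 < x ^ 2 := by positivity
  have hpow : (x ^ σ) ^ 2 = (x ^ 2) ^ σ := by
    rw [← Real.rpow_natCast, ← Real.rpow_mul hx0.le, ← Real.rpow_natCast x 2,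
      ← Real.rpow_mul hx0.le, mul_comm]
  have hsplit : 1 + x ^ 2 = (1 + (x ^ 2)⁻¹) * x ^ 2 := by field_simp; ring
  have hinv : (x ^ 2)⁻¹ ≤ 1 := inv_le_one_of_one_le₀ (by nlinarith)
  have hinv0 : 0 < (x ^ 2)⁻¹ := by positivity
  rw [hpow, hsplit, Real.mul_rpow (by positivity) hx2.le]
  gcongr
  calc (1 + (x ^ 2)⁻¹) ^ σ ≤ (1 + (x ^ 2)⁻¹) ^ |σ| :=
        Real.rpow_le_rpow_of_exponent_le (by linarith) (le_abs_self σ)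
    _ ≤ 2 ^ |σ| := Real.rpow_le_rpow (by positivity) (by linarith) (abs_nonneg σ)

/-- A pointwise bound `w ≤ C W |z|²` on weights yields the bound for the quotient `a / z`. -/
lemma ofReal_mul_nnnorm_div_sq_le {w W C : ℝ} {a z : ℂ} (hC : 0 ≤ C) (hW : 0 ≤ W) (hz : z ≠ 0)
    (h : w ≤ C * W * ‖z‖ ^ 2) :
    ENNReal.ofReal w * (‖a / z‖₊ : ENNReal) ^ 2 ≤
      ENNReal.ofReal C * (ENNReal.ofReal W * (‖a‖₊ : ENNReal) ^ 2) := by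
  have hn : ∀ b : ℂ, (‖b‖₊ : ENNReal) ^ 2 = ENNReal.ofReal (‖b‖ ^ 2) := fun b => by
    rw [ENNReal.ofReal_pow (norm_nonneg b), ofReal_norm]; rfl
  have hz' : 0 < ‖z‖ := norm_pos_iff.mpr hz
  rw [hn, hn, ← ENNReal.ofReal_mul' (by positivity), ← ENNReal.ofReal_mul hW,
    ← ENNReal.ofReal_mul hC]
  apply ENNReal.ofReal_le_ofReal
  calc w * ‖a / z‖ ^ 2 ≤ C * W * ‖z‖ ^ 2 * ‖a / z‖ ^ 2 := by gcongr
    _ = C * (W * ‖a‖ ^ 2) := by rw [norm_div]; field_simp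

theorem stmt18 (d : ℕ) (hd : 2 ≤ d) (s r δ σ : ℝ) (hδ : 1 < δ)
    (hdim : 1 + δ - 2 * r < (d : ℝ)) (hr : 0 ≤ r) (hσ : σ ≤ s) (hrs : 1 - r ≤ s)
    (φ : EuclideanSpace ℝ (Fin d) → ℝ) (hφcont : Continuous φ)
    (c c' : ℝ) (hc : 0 < c) (hcc' : c ≤ c')
    (hφlow : ∀ ξ : EuclideanSpace ℝ (Fin d), 0 < ‖ξ‖ → ‖ξ‖ ≤ 1 →
      c * ‖ξ‖ ^ δ ≤ φ ξ ∧ φ ξ ≤ c' * ‖ξ‖ ^ δ)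
    (hφhigh : ∀ ξ : EuclideanSpace ℝ (Fin d), 1 ≤ ‖ξ‖ →
      c * ‖ξ‖ ^ σ ≤ φ ξ ∧ φ ξ ≤ c' * ‖ξ‖ ^ σ)
    (γ β : ℝ) (hγ : γ ≠ 0) (hβ : β ≠ 0)
    (m : EuclideanSpace ℝ (Fin d) → ℂ)
    (hm : ∀ ξ : EuclideanSpace ℝ (Fin d),
      m ξ = -((2 * Real.pi * γ * ξ ⟨0, by omega⟩ : ℝ) : ℂ) * Complex.I
        + ((β * φ ξ : ℝ) : ℂ)) :
    (∀ ξ : EuclideanSpace ℝ (Fin d), ξ ≠ 0 → m ξ ≠ 0) ∧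
    ∃ C : ℝ, 0 < C ∧ ∀ g : EuclideanSpace ℝ (Fin d) → ℂ, Measurable g →
      ((∫⁻ ξ in Metric.ball (0 : EuclideanSpace ℝ (Fin d)) 1,
          ENNReal.ofReal (‖ξ‖ ^ (-(2 * r))) * (‖g ξ‖₊ : ENNReal) ^ 2) +
        (∫⁻ ξ in (Metric.ball (0 : EuclideanSpace ℝ (Fin d)) 1)ᶜ,
          ENNReal.ofReal ((1 + ‖ξ‖ ^ 2) ^ s) * (‖g ξ‖₊ : ENNReal) ^ 2)) < ⊤ →
      ((∀ᵐ ξ : EuclideanSpace ℝ (Fin d), m ξ * (g ξ / m ξ) = g ξ) ∧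
       (∀ v : EuclideanSpace ℝ (Fin d) → ℂ, Measurable v →
          (∀ᵐ ξ : EuclideanSpace ℝ (Fin d), m ξ * v ξ = g ξ) →
          v =ᵐ[volume] fun ξ => g ξ / m ξ) ∧
       (∫⁻ ξ, omegaW d (by omega) (s + σ) r δ ξ * (‖g ξ / m ξ‖₊ : ENNReal) ^ 2) ≤
         ENNReal.ofReal C *
           ((∫⁻ ξ in Metric.ball (0 : EuclideanSpace ℝ (Fin d)) 1,
              ENNReal.ofReal (‖ξ‖ ^ (-(2 * r))) * (‖g ξ‖₊ : ENNReal) ^ 2) +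
            (∫⁻ ξ in (Metric.ball (0 : EuclideanSpace ℝ (Fin d)) 1)ᶜ,
              ENNReal.ofReal ((1 + ‖ξ‖ ^ 2) ^ s) * (‖g ξ‖₊ : ENNReal) ^ 2))) := by
  have hd0 : 0 < d := by omega
  have : Nonempty (Fin d) := ⟨⟨0, hd0⟩⟩
  have hφ_pos : ∀ ξ : EuclideanSpace ℝ (Fin d), ξ ≠ 0 → 0 < φ ξ := by
    intro ξ hξ
    have hpos : 0 < ‖ξ‖ := norm_pos_iff.mpr hξ
    rcases le_total ‖ξ‖ 1 with h | h
    · exact lt_of_lt_of_le (by positivity) (hφlow ξ hpos h).1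
    · exact lt_of_lt_of_le (by positivity) (hφhigh ξ h).1
  have hm_sq : ∀ ξ, ‖m ξ‖ ^ 2 = (2 * Real.pi * γ) ^ 2 * ξ ⟨0, hd0⟩ ^ 2 + β ^ 2 * φ ξ ^ 2 := by
    intro ξ
    rw [hm, ← Complex.normSq_eq_norm_sq, Complex.normSq_apply]
    simp
    ring
  have hm_ne : ∀ ξ, ξ ≠ 0 → m ξ ≠ 0 := by
    intro ξ hξ h
    have h1 := hm_sq ξ
    have h2 := hφ_pos ξ hξ
    have h3 : 0 < β ^ 2 * φ ξ ^ 2 := by positivity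
    have h4 : 0 ≤ (2 * Real.pi * γ) ^ 2 * ξ ⟨0, hd0⟩ ^ 2 := by positivity
    rw [h, norm_zero] at h1
    linarith
  have h_ae : ∀ᵐ ξ : EuclideanSpace ℝ (Fin d), ξ ≠ 0 := Measure.ae_ne volume 0
  refine ⟨hm_ne, ?_⟩
  have hA : 0 < (2 * Real.pi * γ) ^ 2 := by positivity
  have hB : 0 < β ^ 2 * c ^ 2 := by positivity
  set A := (2 * Real.pi * γ) ^ 2
  have hK : (0 : ℝ) < 2 ^ |σ| := by positivity
  set K : ℝ := 2 ^ |σ|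
  set C : ℝ := A⁻¹ + (β ^ 2 * c ^ 2)⁻¹ * (1 + K) with hC_def
  have hC : 0 < C := by positivity
  have hCA : 1 ≤ C * A := by
    have : C * A = 1 + (β ^ 2 * c ^ 2)⁻¹ * (1 + K) * A := by rw [hC_def]; field_simp
    rw [this]
    exact le_add_of_nonneg_right (by positivity)
  have hCB : 1 + K ≤ C * (β ^ 2 * c ^ 2) := by
    have : C * (β ^ 2 * c ^ 2) = 1 + K + A⁻¹ * (β ^ 2 * c ^ 2) := by
      rw [hC_def]; field_simp; ring
    rw [this]
    exact le_add_of_nonneg_right (by positivity)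
  have h_low : ∀ ξ : EuclideanSpace ℝ (Fin d), ξ ≠ 0 → ‖ξ‖ < 1 →
      (|ξ ⟨0, hd0⟩| ^ 2 + ‖ξ‖ ^ (2 * δ)) / ‖ξ‖ ^ (2 * r) ≤
        C * ‖ξ‖ ^ (-(2 * r)) * ‖m ξ‖ ^ 2 := by
    intro ξ hξ h
    have hpos : 0 < ‖ξ‖ := norm_pos_iff.mpr hξ
    have hsq : ‖ξ‖ ^ (2 * δ) = (‖ξ‖ ^ δ) ^ 2 := by
      rw [← Real.rpow_natCast, ← Real.rpow_mul hpos.le, mul_comm]; norm_num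
    have hφ2 : (c * ‖ξ‖ ^ δ) ^ 2 ≤ φ ξ ^ 2 :=
      pow_le_pow_left₀ (by positivity) (hφlow ξ hpos h.le).1 2
    have key : |ξ ⟨0, hd0⟩| ^ 2 + ‖ξ‖ ^ (2 * δ) ≤ C * ‖m ξ‖ ^ 2 := by
      rw [hm_sq, sq_abs, hsq]
      calc ξ ⟨0, hd0⟩ ^ 2 + (‖ξ‖ ^ δ) ^ 2
          ≤ (C * A) * ξ ⟨0, hd0⟩ ^ 2 + (C * (β ^ 2 * c ^ 2)) * (‖ξ‖ ^ δ) ^ 2 :=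
            add_le_add (le_mul_of_one_le_left (by positivity) hCA)
              (le_mul_of_one_le_left (by positivity) (by linarith))
        _ = C * (A * ξ ⟨0, hd0⟩ ^ 2 + β ^ 2 * (c * ‖ξ‖ ^ δ) ^ 2) := by ring
        _ ≤ C * (A * ξ ⟨0, hd0⟩ ^ 2 + β ^ 2 * φ ξ ^ 2) := by gcongr
    rw [Real.rpow_neg hpos.le, div_eq_mul_inv]
    calc _ ≤ C * ‖m ξ‖ ^ 2 * (‖ξ‖ ^ (2 * r))⁻¹ := by gcongr
      _ = _ := by ring
  have h_high : ∀ ξ : EuclideanSpace ℝ (Fin d), 1 ≤ ‖ξ‖ →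
      (1 + ‖ξ‖ ^ 2) ^ (s + σ) ≤ C * (1 + ‖ξ‖ ^ 2) ^ s * ‖m ξ‖ ^ 2 := by
    intro ξ h
    have hφ2 : (c * ‖ξ‖ ^ σ) ^ 2 ≤ φ ξ ^ 2 :=
      pow_le_pow_left₀ (by positivity) (hφhigh ξ h).1 2
    have key : (1 + ‖ξ‖ ^ 2) ^ σ ≤ C * ‖m ξ‖ ^ 2 := by
      rw [hm_sq]
      calc (1 + ‖ξ‖ ^ 2) ^ σ ≤ K * (‖ξ‖ ^ σ) ^ 2 := one_add_sq_rpow_le h σ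
        _ ≤ (C * (β ^ 2 * c ^ 2)) * (‖ξ‖ ^ σ) ^ 2 := by gcongr; linarith
        _ = C * (β ^ 2 * (c * ‖ξ‖ ^ σ) ^ 2) := by ring
        _ ≤ C * (β ^ 2 * φ ξ ^ 2) := by gcongr
        _ ≤ C * (A * ξ ⟨0, hd0⟩ ^ 2 + β ^ 2 * φ ξ ^ 2) := by
            gcongr
            exact le_add_of_nonneg_left (by positivity)
    rw [Real.rpow_add (by positivity)]
    calc _ ≤ (1 + ‖ξ‖ ^ 2) ^ s * (C * ‖m ξ‖ ^ 2) := by gcongr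
      _ = _ := by ring
  refine ⟨C, hC, fun g _ _ => ⟨?_, ?_, ?_⟩⟩
  · filter_upwards [h_ae] with ξ hξ
    exact mul_div_cancel₀ _ (hm_ne ξ hξ)
  · intro v _ hv
    filter_upwards [h_ae, hv] with ξ hξ h
    rw [← h, mul_div_cancel_left₀ _ (hm_ne ξ hξ)]
  · rw [← lintegral_add_compl _ (measurableSet_ball (x := (0 : EuclideanSpace ℝ (Fin d))) (ε := 1)),
      mul_add, ← lintegral_const_mul' _ _ ENNReal.ofReal_ne_top,
      ← lintegral_const_mul' _ _ ENNReal.ofReal_ne_top]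
    refine add_le_add (lintegral_mono_ae ?_) (lintegral_mono_ae ?_)
    · filter_upwards [ae_restrict_of_ae h_ae, ae_restrict_mem measurableSet_ball] with ξ hξ hb
      have hb' : ‖ξ‖ < 1 := by simpa using hb
      rw [omegaW, if_pos hb']
      exact ofReal_mul_nnnorm_div_sq_le hC.le (by positivity) (hm_ne ξ hξ) (h_low ξ hξ hb')
    · filter_upwards [ae_restrict_of_ae h_ae, ae_restrict_mem measurableSet_ball.compl]
        with ξ hξ hb
      have hb' : 1 ≤ ‖ξ‖ := by simpa using hb
      rw [omegaW, if_neg hb'.not_gt]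
      exact ofReal_mul_nnnorm_div_sq_le hC.le (by positivity) (hm_ne ξ hξ) (h_high ξ hb')
end
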